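/- arXiv:1805.05071 — 6 statements merged into one kernel-verified Lean document; each statement's English description precedes it below -/
import Mathlib

section
/- Let X_1, …, X_n be i.i.d. random variables with distribution ν on [0,1] such that E(ν) ∈ (0,1), and let ν̂_n = (1/n) Σ_{i=1}^n δ_{X_i} be their empirical distribution. Then for all u ≥ 0, P[ K_inf(ν̂_n, E(ν)) ≥ u ] ≤ e (2n + 1) e^{−n u}. -/
open MeasureTheory ProbabilityTheory Real ENNReal
open scoped Classical

/-- Kullback–Leibler divergence between two measures on `ℝ`, equal to
`∫ ln(dν/dν') dν` when `ν ≪ ν'` (and this integral is well defined), and `+∞` otherwise. -/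
noncomputable def KL (ν ν' : Measure ℝ) : ℝ≥0∞ :=
  if ν ≪ ν' ∧ Integrable (fun x => Real.log ((ν.rnDeriv ν' x).toReal)) ν
  then ENNReal.ofReal (∫ x, Real.log ((ν.rnDeriv ν' x).toReal) ∂ν)
  else ⊤

/-- `K_inf(ν, x)`: infimum of `KL(ν, ν')` over probability measures `ν'` on `[0,1]`
with mean `> x`. The infimum of the empty set is `+∞`. -/
noncomputable def Kinf (ν : Measure ℝ) (x : ℝ) : ℝ≥0∞ :=
  ⨅ (ν' : Measure ℝ) (_ : IsProbabilityMeasure ν')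
    (_ : ν' (Set.Icc (0:ℝ) 1)ᶜ = 0) (_ : x < ∫ y, y ∂ν'), KL ν ν'

/-- The empirical distribution `(1/n) ∑_{i=1}^n δ_{X_i(ω)}` of `n` random variables. -/
noncomputable def emp {Ω : Type*} {n : ℕ} (X : Fin n → Ω → ℝ) (ω : Ω) : Measure ℝ :=
  (n : ℝ≥0∞)⁻¹ • ∑ i : Fin n, Measure.dirac (X i ω)


lemma kd_opt {n : ℕ} (c : Fin n → ℝ) (hc : ∀ i, c i ≤ 1) :
    ∃ l ∈ Set.Icc (0:ℝ) 1, (∀ i, 0 < 1 - l * c i) ∧ 1 ≤ ∏ i, (1 - l * c i) ∧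
      l * ∑ i, c i / (1 - l * c i) ≤ 0 ∧ 0 ≤ (1 - l) * ∑ i, c i / (1 - l * c i) := by
  obtain ⟨l, hl, hmax⟩ := (isCompact_Icc (a := (0:ℝ)) (b := 1)).exists_isMaxOn
    ⟨0, by simp⟩ (f := fun l => ∏ i, (1 - l * c i)) (by fun_prop)
  have h1 : 1 ≤ ∏ i, (1 - l * c i) := by
    have := hmax (show (0:ℝ) ∈ Set.Icc (0:ℝ) 1 by simp)
    simpa using this
  have hnn : ∀ i, 0 ≤ 1 - l * c i := fun i => by
    obtain ⟨h0, h2⟩ := hl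
    nlinarith [hc i]
  have hpos : ∀ i, 0 < 1 - l * c i := fun i => by
    refine lt_of_le_of_ne (hnn i) fun h => ?_
    have : ∏ i, (1 - l * c i) = 0 := Finset.prod_eq_zero (Finset.mem_univ i) h.symm
    linarith
  have hloc : IsLocalMaxOn (fun t => ∑ i, Real.log (1 - t * c i)) (Set.Icc 0 1) l := by
    have hev : ∀ᶠ t in nhds l, ∀ i, 0 < 1 - t * c i := by
      rw [Filter.eventually_all]
      intro i
      have : ContinuousAt (fun t => 1 - t * c i) l := by fun_prop
      exact this.eventually (lt_mem_nhds (hpos i))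
    have hev' := hev.filter_mono (nhdsWithin_le_nhds (s := Set.Icc (0:ℝ) 1))
    filter_upwards [hev', self_mem_nhdsWithin] with t ht htI
    rw [← Real.log_prod (fun i _ => (ht i).ne'), ← Real.log_prod (fun i _ => (hpos i).ne')]
    exact Real.log_le_log (Finset.prod_pos fun i _ => ht i) (hmax htI)
  have hder : HasDerivAt (fun t => ∑ i, Real.log (1 - t * c i))
      (∑ i, (-(1 * c i)) / (1 - l * c i)) l := by
    refine HasDerivAt.fun_sum fun i _ => ?_
    exact (((hasDerivAt_id l).mul_const (c i)).const_sub 1).log (hpos i).ne'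
  have hS : ∑ i, (-(1 * c i)) / (1 - l * c i) = - ∑ i, c i / (1 - l * c i) := by
    rw [← Finset.sum_neg_distrib]
    exact Finset.sum_congr rfl fun i _ => by ring
  rw [hS] at hder
  have key : ∀ y ∈ Set.Icc (0:ℝ) 1, (y - l) * (- ∑ i, c i / (1 - l * c i)) ≤ 0 := by
    intro y hy
    have := hloc.hasFDerivWithinAt_nonpos hder.hasFDerivAt.hasFDerivWithinAt
      (sub_mem_posTangentConeAt_of_segment_subset ((convex_Icc 0 1).segment_subset hl hy))
    simpa using this
  refine ⟨l, hl, hpos, h1, ?_, ?_⟩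
  · have := key 0 (by simp); linarith
  · have := key 1 (by simp); linarith

lemma kd_grid {n : ℕ} (hn : 1 ≤ n) (c : Fin n → ℝ) (hc : ∀ i, c i ≤ 1) (l : ℝ)
    (hl : l ∈ Set.Icc (0:ℝ) 1) :
    ∃ j ∈ Finset.range (2 * n + 1),
      1 / 2 * ∏ i, (1 - l * c i) ≤ ∏ i, (1 - ((j : ℝ) / (2 * n)) * c i) := by
  obtain ⟨h0, h1⟩ := hl
  have hn' : (1:ℝ) ≤ n := by exact_mod_cast hn
  have hA : (0:ℝ) ≤ (2 * n - 1) * l := by nlinarith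
  have hj1 := Nat.le_ceil ((2 * n - 1) * l)
  have hj2 := Nat.ceil_lt_add_one hA
  have hj3 : ⌈(2 * (n:ℝ) - 1) * l⌉₊ ≤ 2 * n := by
    apply Nat.ceil_le.2; push_cast; nlinarith
  refine ⟨⌈(2 * (n:ℝ) - 1) * l⌉₊, Finset.mem_range.2 (by omega), ?_⟩
  generalize ⌈(2 * (n:ℝ) - 1) * l⌉₊ = j at *
  have hnn : ∀ i, 0 ≤ 1 - l * c i := fun i => by nlinarith [hc i]
  have hb : (1:ℝ) / 2 ≤ (1 - 1 / (2 * n)) ^ n := by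
    have := one_add_mul_le_pow (a := -(1 / (2 * (n:ℝ)))) (by
      have : 1 / (2 * (n:ℝ)) ≤ 1 := by rw [div_le_one (by linarith)]; linarith
      linarith) n
    have h2 : 1 + (n:ℝ) * -(1 / (2 * (n:ℝ))) = 1 / 2 := by field_simp; norm_num
    rw [h2] at this
    rwa [sub_eq_add_neg]
  calc 1 / 2 * ∏ i, (1 - l * c i) ≤ (1 - 1 / (2 * n)) ^ n * ∏ i, (1 - l * c i) :=
        mul_le_mul_of_nonneg_right hb (Finset.prod_nonneg fun i _ => hnn i)
    _ = ∏ i, ((1 - 1 / (2 * (n:ℝ))) * (1 - l * c i)) := by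
        rw [Finset.prod_mul_distrib]; simp
    _ ≤ _ := by
        have h3 : 1 / (2 * (n:ℝ)) ≤ 1 := by rw [div_le_one (by linarith)]; linarith
        refine Finset.prod_le_prod (fun i _ => mul_nonneg (by linarith) (hnn i)) fun i _ => ?_
        have : 1 - (j:ℝ) / (2 * n) * c i - (1 - 1 / (2 * (n:ℝ))) * (1 - l * c i)
          = (1 - (j - (2 * n - 1) * l) * c i) / (2 * n) := by field_simp; ring
        have h4 : 0 ≤ (1 - (j - (2 * n - 1) * l) * c i) / (2 * n) := by
          apply div_nonneg _ (by linarith)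
          nlinarith [hc i]
        linarith

lemma kd_KL {n : ℕ} (hn : 1 ≤ n) (x : Fin n → ℝ) (w : ℝ → ℝ) (hw : ∀ i, 0 < w (x i))
    (κ : Measure ℝ) :
    let ν' := ∑ i, ENNReal.ofReal (w (x i) / n) • Measure.dirac (x i) + κ
    IsProbabilityMeasure ν' →
    KL ((n : ℝ≥0∞)⁻¹ • ∑ i : Fin n, Measure.dirac (x i)) ν'
      ≤ ENNReal.ofReal (1 / n * ∑ i, - Real.log (w (x i))) := by
  intro ν' hν'
  have hn0 : (0:ℝ) < n := by exact_mod_cast hn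
  have hn1 : (n:ℝ≥0∞) ≠ 0 := by simp; omega
  set m : Measure ℝ := (n : ℝ≥0∞)⁻¹ • ∑ i : Fin n, Measure.dirac (x i) with hm
  have hmf : IsFiniteMeasure m := by
    rw [hm]
    refine ⟨?_⟩
    simp [lt_top_iff_ne_top]
  -- atoms
  have hac : m ≪ ν' := by
    refine Measure.AbsolutelyContinuous.mk fun s hs h => ?_
    simp only [ν', Measure.add_apply, Measure.coe_finsetSum, Finset.sum_apply,
      Measure.smul_apply, smul_eq_mul, add_eq_zero, Finset.sum_eq_zero_iff] at h
    simp only [hm, Measure.coe_finsetSum, Finset.sum_apply,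
      Measure.smul_apply, smul_eq_mul, mul_eq_zero, Finset.sum_eq_zero_iff]
    right
    intro i hi
    rcases mul_eq_zero.1 (h.1 i hi) with h' | h'
    · rw [ENNReal.ofReal_eq_zero] at h'
      have := div_pos (hw i) hn0
      linarith
    · exact h'
  have hge : ∀ i, ENNReal.ofReal (w (x i)) * m {x i} ≤ ν' {x i} := by
    intro i
    simp only [ν', hm, Measure.add_apply, Measure.coe_finsetSum, Finset.sum_apply,
      Measure.smul_apply, smul_eq_mul]
    refine le_add_right ?_
    rw [Finset.mul_sum, Finset.mul_sum]
    refine Finset.sum_le_sum fun j _ => ?_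
    by_cases h : x j = x i
    · rw [h, ENNReal.ofReal_div_of_pos hn0, ENNReal.ofReal_natCast, div_eq_mul_inv, mul_assoc]
    · simp [h]
  have hmpos : ∀ i, m {x i} ≠ 0 := by
    intro i h
    simp only [hm, Measure.coe_finsetSum, Finset.sum_apply,
      Measure.smul_apply, smul_eq_mul, mul_eq_zero, Finset.sum_eq_zero_iff] at h
    rcases h with h | h
    · simp at h
    · simpa using h i (Finset.mem_univ i)
  have hf : ∀ i, m {x i} = m.rnDeriv ν' (x i) * ν' {x i} := by
    intro i
    conv_lhs => rw [← Measure.withDensity_rnDeriv_eq m ν' hac]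
    rw [withDensity_apply _ (measurableSet_singleton _), lintegral_singleton]
  have hlog : ∀ i, Real.log ((m.rnDeriv ν' (x i)).toReal) ≤ - Real.log (w (x i)) := by
    intro i
    have h1 := hf i
    have h2 := hge i
    have h3 : 0 < (m {x i}).toReal := ENNReal.toReal_pos (hmpos i) (measure_ne_top _ _)
    have h4 : (m {x i}).toReal = (m.rnDeriv ν' (x i)).toReal * (ν' {x i}).toReal := by
      rw [← ENNReal.toReal_mul, ← h1]
    have h5 : w (x i) * (m {x i}).toReal ≤ (ν' {x i}).toReal := by
      have := ENNReal.toReal_mono (measure_ne_top _ _) h2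
      rwa [ENNReal.toReal_mul, ENNReal.toReal_ofReal (hw i).le] at this
    have h6 : 0 < (ν' {x i}).toReal := lt_of_lt_of_le (mul_pos (hw i) h3) h5
    generalize (m {x i}).toReal = a at *
    generalize (ν' {x i}).toReal = b at *
    generalize (m.rnDeriv ν' (x i)).toReal = r at *
    rw [← Real.log_inv]
    have hr : 0 < r := by
      by_contra h
      nlinarith
    refine Real.log_le_log hr ?_
    rw [le_inv_comm₀ hr (hw i), ← one_div, le_div_iff₀ hr]
    subst h4
    by_contra h
    nlinarith
  have hint : Integrable (fun y => Real.log ((m.rnDeriv ν' y).toReal)) m := by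
    rw [hm]
    refine Integrable.smul_measure ?_ (by simpa using hn1)
    rw [integrable_finsetSum_measure]
    intro i _
    exact integrable_dirac (by simp)
  unfold KL
  rw [if_pos ⟨hac, hint⟩]
  refine ENNReal.ofReal_le_ofReal ?_
  have hF : ∀ F : ℝ → ℝ, ∫ y, F y ∂m = 1 / n * ∑ i, F (x i) := by
    intro F
    rw [hm, integral_smul_measure, integral_finsetSum_measure]
    · simp [integral_dirac]
    · intro i _
      exact integrable_dirac (by simp)
  rw [hF]
  gcongr with i
  exact hlog i

lemma kd_dual {n : ℕ} (hn : 1 ≤ n) (x : Fin n → ℝ) (hx : ∀ i, x i ∈ Set.Icc (0:ℝ) 1)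
    (μ : ℝ) (hμ : μ ∈ Set.Ioo (0:ℝ) 1) (u : ℝ)
    (h : ENNReal.ofReal u ≤ Kinf ((n : ℝ≥0∞)⁻¹ • ∑ i : Fin n, Measure.dirac (x i)) μ) :
    ∃ j ∈ Finset.range (2 * n + 1), Real.exp (n * u - 1) ≤
      ∏ i, (1 - ((j : ℝ) / (2 * n)) * ((x i - μ) / (1 - μ))) := by
  obtain ⟨hμ0, hμ1⟩ := hμ
  have hn' : (1:ℝ) ≤ n := by exact_mod_cast hn
  have hn0 : (0:ℝ) < n := by linarith
  have hμ2 : 0 < 1 - μ := by linarith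
  set c : Fin n → ℝ := fun i => (x i - μ) / (1 - μ) with hcdef
  have hc : ∀ i, c i ≤ 1 := fun i => by
    rw [hcdef]; simp only
    rw [div_le_one hμ2]; linarith [(hx i).2]
  obtain ⟨l, hl, hpos, hW1, hS1, hS2⟩ := kd_opt c hc
  obtain ⟨j, hj, hjW⟩ := kd_grid hn c hc l hl
  refine ⟨j, hj, ?_⟩
  -- the alternative distribution
  set η : ℝ := 1 / (4 * n) with hη
  have hη0 : 0 < η := by positivity
  have hη1 : η ≤ 1 / 4 := by
    rw [hη, div_le_div_iff₀ (by linarith) (by norm_num)]; linarith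
  set w : ℝ → ℝ := fun y => (1 - η) / (1 - l * ((y - μ) / (1 - μ))) with hwdef
  have hw : ∀ i, w (x i) = (1 - η) / (1 - l * c i) := fun i => rfl
  have hwpos : ∀ i, 0 < w (x i) := fun i => by
    rw [hw]; exact div_pos (by linarith) (hpos i)
  set S := ∑ i, c i / (1 - l * c i) with hSdef
  have hsum1 : ∑ i, 1 / (1 - l * c i) = n + l * S := by
    have : ∀ i, 1 / (1 - l * c i) = 1 + l * (c i / (1 - l * c i)) := fun i => by
      have := (hpos i).ne'
      field_simp
      ring
    simp_rw [this]
    rw [Finset.sum_add_distrib, ← Finset.mul_sum, ← hSdef]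
    simp
  have hA : ∑ i, w (x i) / n = (1 - η) / n * (n + l * S) := by
    rw [← hsum1, Finset.mul_sum]
    exact Finset.sum_congr rfl fun i _ => by rw [hw]; field_simp
  have hA1 : ∑ i, w (x i) / n ≤ 1 := by
    rw [hA]
    have : (1 - η) / n * (n + l * S) ≤ (1 - η) / n * n := by
      apply mul_le_mul_of_nonneg_left _ (div_nonneg (by linarith) hn0.le)
      linarith
    rw [div_mul_cancel₀ _ hn0.ne'] at this
    linarith
  have hB : ∑ i, w (x i) / n * c i = (1 - η) / n * S := by
    rw [hSdef, Finset.mul_sum]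
    exact Finset.sum_congr rfl fun i _ => by rw [hw]; field_simp
  set A := ∑ i, w (x i) / n with hAdef
  set ν' : Measure ℝ := ∑ i, ENNReal.ofReal (w (x i) / n) • Measure.dirac (x i)
    + ENNReal.ofReal (1 - A) • Measure.dirac 1 with hν'
  have hwn : ∀ i, 0 ≤ w (x i) / n := fun i => (div_pos (hwpos i) hn0).le
  have hprob : IsProbabilityMeasure ν' := by
    refine ⟨?_⟩
    rw [hν']
    simp only [Measure.add_apply, Measure.coe_finsetSum, Finset.sum_apply,
      Measure.smul_apply, smul_eq_mul, measure_univ, mul_one]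
    rw [← ENNReal.ofReal_sum_of_nonneg (fun i _ => hwn i), ← ENNReal.ofReal_add
      (Finset.sum_nonneg fun i _ => hwn i) (by linarith)]
    simp [← hAdef]
  have hsup : ν' (Set.Icc (0:ℝ) 1)ᶜ = 0 := by
    rw [hν']
    simp only [Measure.add_apply, Measure.coe_finsetSum, Finset.sum_apply,
      Measure.smul_apply, smul_eq_mul]
    simp [fun i => (hx i).1, fun i => (hx i).2]
  have hmean : ∫ y, y ∂ν' = ∑ i, w (x i) / n * x i + (1 - A) := by
    have hi : ∀ i ∈ Finset.univ, Integrable (fun y : ℝ => y)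
        (ENNReal.ofReal (w (x i) / n) • Measure.dirac (x i)) := fun i _ =>
      Integrable.smul_measure (integrable_dirac (by simp)) (by simp)
    rw [hν', integral_add_measure (integrable_finsetSum_measure.2 hi)
      (Integrable.smul_measure (integrable_dirac (by simp)) (by simp)),
      integral_finsetSum_measure hi]
    simp only [integral_smul_measure, integral_dirac, smul_eq_mul]
    rw [ENNReal.toReal_ofReal (by linarith)]
    simp only [ENNReal.toReal_ofReal (hwn _), mul_one]
  have hmean' : μ < ∫ y, y ∂ν' := by
    have e : ∑ i, w (x i) / n * x i = (1 - μ) * ((1 - η) / n * S) + μ * A := by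
      rw [← hB, hAdef, Finset.mul_sum, Finset.mul_sum, ← Finset.sum_add_distrib]
      refine Finset.sum_congr rfl fun i _ => ?_
      have : x i = (1 - μ) * c i + μ := by
        rw [hcdef]; field_simp; ring
      rw [this]
      generalize w _ = q
      have : (1 - μ) * c i + μ = x i := this.symm
      ring
    rw [hmean, e, hA]
    have e2 : (1 - μ) * ((1 - η) / n * S) + μ * ((1 - η) / n * (n + l * S))
        + (1 - (1 - η) / n * (n + l * S))
        = μ + (1 - μ) * (η + (1 - η) / n * ((1 - l) * S)) := by
      field_simp; ring
    rw [e2]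
    have : 0 ≤ (1 - η) / n * ((1 - l) * S) :=
      mul_nonneg (div_nonneg (by linarith) hn0.le) hS2
    have : 0 < (1 - μ) * (η + (1 - η) / n * ((1 - l) * S)) := by positivity
    linarith
  have hK : Kinf ((n : ℝ≥0∞)⁻¹ • ∑ i : Fin n, Measure.dirac (x i)) μ
      ≤ KL ((n : ℝ≥0∞)⁻¹ • ∑ i : Fin n, Measure.dirac (x i)) ν' := by
    unfold Kinf
    exact iInf_le_of_le ν' (iInf_le_of_le hprob (iInf_le_of_le hsup (iInf_le_of_le hmean' le_rfl)))
  have hfin := h.trans (hK.trans (kd_KL hn x w hwpos _ hprob))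
  have hval : ∑ i, - Real.log (w (x i)) =
      Real.log (∏ i, (1 - l * c i)) - n * Real.log (1 - η) := by
    rw [Real.log_prod (fun i _ => (hpos i).ne')]
    have : ∀ i, - Real.log (w (x i)) = Real.log (1 - l * c i) - Real.log (1 - η) := fun i => by
      rw [hw, Real.log_div (by linarith) (hpos i).ne']; ring
    simp_rw [this]
    rw [Finset.sum_sub_distrib]
    simp
  rw [hval] at hfin
  have hlogη : Real.log (1 - η) ≤ 0 := Real.log_nonpos (by linarith) (by linarith)
  have hlogW : 0 ≤ Real.log (∏ i, (1 - l * c i)) := Real.log_nonneg hW1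
  have hu : u ≤ 1 / n * (Real.log (∏ i, (1 - l * c i)) - n * Real.log (1 - η)) := by
    refine (ENNReal.ofReal_le_ofReal_iff (mul_nonneg (by positivity) ?_)).1 hfin
    nlinarith
  have hnu : n * u + n * Real.log (1 - η) ≤ Real.log (∏ i, (1 - l * c i)) := by
    have := mul_le_mul_of_nonneg_left hu hn0.le
    rw [← mul_assoc, mul_one_div_cancel hn0.ne', one_mul] at this
    linarith
  have hWpos : 0 < ∏ i, (1 - l * c i) := by linarith
  have hexp : Real.exp (n * u) * (1 - η) ^ n ≤ ∏ i, (1 - l * c i) := by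
    rw [← Real.exp_log (show 0 < 1 - η by linarith), ← Real.exp_nat_mul, ← Real.exp_add]
    exact (Real.le_log_iff_exp_le hWpos).1 hnu
  have hb : 3 / 4 ≤ (1 - η) ^ n := by
    have := one_add_mul_le_pow (a := -η) (by linarith) n
    have h2 : 1 + (n:ℝ) * -η = 3 / 4 := by rw [hη]; field_simp; norm_num
    rw [h2] at this
    rwa [sub_eq_add_neg]
  refine le_trans ?_ hjW
  have he : Real.exp (-1) ≤ 3 / 8 := by
    rw [Real.exp_neg, inv_le_comm₀ (Real.exp_pos _) (by norm_num)]
    have := Real.exp_one_gt_d9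
    norm_num at this ⊢
    linarith
  have hp := Real.exp_pos (n * u)
  rw [sub_eq_add_neg, Real.exp_add]
  nlinarith [mul_le_mul_of_nonneg_left hb hp.le, mul_le_mul_of_nonneg_left he hp.le]

lemma kd_markov {Ω : Type*} [MeasurableSpace Ω] (P : Measure Ω) [IsProbabilityMeasure P]
    (ν : Measure ℝ) [IsProbabilityMeasure ν] (hsupp : ν (Set.Icc (0:ℝ) 1)ᶜ = 0)
    (hmean : (∫ y, y ∂ν) ∈ Set.Ioo (0:ℝ) 1)
    (n : ℕ) (X : Fin n → Ω → ℝ) (hmeas : ∀ i, Measurable (X i))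
    (hindep : iIndepFun X P)
    (hdist : ∀ i, Measure.map (X i) P = ν) (l : ℝ) (hl : l ∈ Set.Icc (0:ℝ) 1) (t : ℝ) :
    P {ω | ENNReal.ofReal (Real.exp t) ≤
        ∏ i, ENNReal.ofReal (1 - l * ((X i ω - ∫ y, y ∂ν) / (1 - ∫ y, y ∂ν)))}
      ≤ ENNReal.ofReal (Real.exp (-t)) := by
  set μ := ∫ y, y ∂ν with hμ
  obtain ⟨hμ0, hμ1⟩ := hmean
  have hμ2 : 0 < 1 - μ := by linarith
  set φ : ℝ → ℝ≥0∞ := fun y => ENNReal.ofReal (1 - l * ((y - μ) / (1 - μ))) with hφ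
  have hφm : Measurable φ := by rw [hφ]; fun_prop
  have hint : Integrable (fun y : ℝ => y) ν := by
    by_contra h
    rw [hμ, integral_undef h] at hμ0
    exact lt_irrefl _ hμ0
  have hone : ∫⁻ y, φ y ∂ν = 1 := by
    have hi1 : Integrable (fun y => l * ((y - μ) / (1 - μ))) ν :=
      ((hint.sub (integrable_const _)).div_const _).const_mul _
    have hi2 : Integrable (fun y => 1 - l * ((y - μ) / (1 - μ))) ν :=
      (integrable_const _).sub hi1
    rw [hφ, ← ofReal_integral_eq_lintegral_ofReal hi2]
    · rw [integral_sub (integrable_const _) hi1, integral_const_mul,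
        integral_div, integral_sub hint (integrable_const _), ← hμ]
      simp
    · have hae : ∀ᵐ y ∂ν, y ∈ Set.Icc (0:ℝ) 1 := hsupp
      filter_upwards [hae] with y hy
      have : (y - μ) / (1 - μ) ≤ 1 := by rw [div_le_one hμ2]; linarith [hy.2]
      simp only [Pi.zero_apply]
      nlinarith [hl.1, hl.2]
  have hprod : ∫⁻ ω, ∏ i, φ (X i ω) ∂P = 1 := by
    have := lintegral_prod_eq_prod_lintegral_of_indepFun (μ := P) Finset.univ
      (fun i => φ ∘ X i) (hindep.comp _ fun _ => hφm) (fun i => hφm.comp (hmeas i))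
    simp only [Function.comp_apply] at this
    rw [this]
    refine Finset.prod_eq_one fun i _ => ?_
    rw [← lintegral_map hφm (hmeas i), hdist, hone]
  have hM := mul_meas_ge_le_lintegral (μ := P) (f := fun ω => ∏ i, φ (X i ω))
    (Finset.measurable_fun_prod _ fun i _ => hφm.comp (hmeas i)) (ENNReal.ofReal (Real.exp t))
  rw [hprod] at hM
  have hpos : 0 < Real.exp t := Real.exp_pos t
  rw [Real.exp_neg, ENNReal.ofReal_inv_of_pos hpos]
  rw [mul_comm] at hM
  have := ENNReal.le_div_iff_mul_le (a := P {ω | ENNReal.ofReal (Real.exp t) ≤ ∏ i, φ (X i ω)})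
    (b := ENNReal.ofReal (Real.exp t)) (c := 1) (by left; simpa using hpos) (by left; simp)
  rw [← one_div]
  exact this.2 hM

/-- Deviation bound for `K_inf`: if `X_1, …, X_n` are i.i.d. with distribution `ν` on `[0,1]`
and `E(ν) ∈ (0,1)`, then for `u ≥ 0`,
`P[K_inf(ν̂_n, E(ν)) ≥ u] ≤ e (2n+1) e^{−nu}`. -/
theorem kinf_deviation {Ω : Type*} [MeasurableSpace Ω] (P : Measure Ω) [IsProbabilityMeasure P]
    (ν : Measure ℝ) [IsProbabilityMeasure ν] (hsupp : ν (Set.Icc (0:ℝ) 1)ᶜ = 0)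
    (hmean : (∫ y, y ∂ν) ∈ Set.Ioo (0:ℝ) 1)
    (n : ℕ) (hn : 1 ≤ n) (X : Fin n → Ω → ℝ) (hmeas : ∀ i, Measurable (X i))
    (hindep : iIndepFun X P)
    (hdist : ∀ i, Measure.map (X i) P = ν)
    (u : ℝ) (hu : 0 ≤ u) :
    P {ω | ENNReal.ofReal u ≤ Kinf (emp X ω) (∫ y, y ∂ν)}
      ≤ ENNReal.ofReal (Real.exp 1 * (2 * n + 1) * Real.exp (-(n * u))) := by
  set μ := ∫ y, y ∂ν with hμ
  have hn' : (1:ℝ) ≤ n := by exact_mod_cast hn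
  have hae : ∀ i, ∀ᵐ ω ∂P, X i ω ∈ Set.Icc (0:ℝ) 1 := fun i => by
    have hae : ∀ᵐ y ∂ν, y ∈ Set.Icc (0:ℝ) 1 := hsupp
    rw [← hdist i] at hae
    exact ae_of_ae_map (hmeas i).aemeasurable hae
  have hle : P {ω | ENNReal.ofReal u ≤ Kinf (emp X ω) μ} ≤
      P (⋃ j ∈ Finset.range (2 * n + 1), {ω | ENNReal.ofReal (Real.exp (n * u - 1)) ≤
        ∏ i, ENNReal.ofReal (1 - ((j : ℝ) / (2 * n)) * ((X i ω - μ) / (1 - μ)))}) := by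
    refine measure_mono_ae ?_
    filter_upwards [ae_all_iff.2 hae] with ω hω hK
    obtain ⟨j, hj, h⟩ := kd_dual hn (fun i => X i ω) hω μ hmean u hK
    refine Set.mem_biUnion hj ?_
    rw [Set.mem_ofPred_eq, ← ENNReal.ofReal_prod_of_nonneg]
    · exact ENNReal.ofReal_le_ofReal h
    · intro i _
      have h1 : (X i ω - μ) / (1 - μ) ≤ 1 := by
        rw [div_le_one (by linarith [hmean.2])]; linarith [(hω i).2]
      have h2 : (j:ℝ) / (2 * n) ≤ 1 := by
        rw [div_le_one (by linarith)]
        have := Finset.mem_range.1 hj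
        exact_mod_cast Nat.lt_succ_iff.1 this
      have h3 : (0:ℝ) ≤ (j:ℝ) / (2 * n) := by positivity
      nlinarith
  refine hle.trans ((measure_biUnion_finset_le _ _).trans ?_)
  have hsum : ∀ j ∈ Finset.range (2 * n + 1), P {ω | ENNReal.ofReal (Real.exp (n * u - 1)) ≤
        ∏ i, ENNReal.ofReal (1 - ((j : ℝ) / (2 * n)) * ((X i ω - μ) / (1 - μ)))}
      ≤ ENNReal.ofReal (Real.exp (-(n * u - 1))) := by
    intro j hj
    refine kd_markov P ν hsupp hmean n X hmeas hindep hdist _ ⟨by positivity, ?_⟩ _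
    rw [div_le_one (by linarith)]
    have := Finset.mem_range.1 hj
    exact_mod_cast Nat.lt_succ_iff.1 this
  refine (Finset.sum_le_sum hsum).trans (le_of_eq ?_)
  rw [Finset.sum_const, Finset.card_range, nsmul_eq_mul, ← ENNReal.ofReal_natCast,
    ← ENNReal.ofReal_mul (by positivity)]
  congr 1
  rw [show -((n:ℝ) * u - 1) = 1 + -(n * u) by ring, Real.exp_add]
  push_cast
  ring
end

section
/- Let X_1, …, X_n be i.i.d. random variables with distribution ν on [0,1] such that E(ν) ∈ (0,1), let ν̂_n = (1/n) Σ_{i=1}^n δ_{X_i} be their empirical distribution and, for ε > 0, define the random index U_{ε,n} = sup{ μ ∈ [0,1] : K_inf(ν̂_n, μ) ≤ ε }. Then E[ (E(ν) − U_{ε,n})⁺ ] ≤ (2n + 1) e^{−n ε} √(π / n), where (x)⁺ = max(x, 0). -/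
open MeasureTheory ProbabilityTheory Real ENNReal
open scoped Classical

/-- The affine function of `x` equal to `1` at `μ` and to `1 - l` at `1`. -/
noncomputable def gg (μ l x : ℝ) : ℝ := 1 - l * ((x - μ) / (1 - μ))

lemma gg_nonneg {μ l x : ℝ} (hμ1 : μ < 1) (hl0 : 0 ≤ l) (hl1 : l ≤ 1)
    (hx1 : x ≤ 1) : 0 ≤ gg μ l x := by
  have h : (x - μ) / (1 - μ) ≤ 1 := by
    rw [div_le_one (by linarith)]; linarith
  unfold gg
  nlinarith

lemma opt_exists {n : ℕ} (x : Fin n → ℝ) (hx1 : ∀ i, x i ≤ 1)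
    {m : ℝ} (hm1 : m < 1) :
    ∃ l : ℝ, 0 ≤ l ∧ l ≤ 1 ∧ (∀ i, 0 < gg m l (x i)) ∧
      l * ∑ i, (x i - m) / gg m l (x i) ≤ 0 ∧
      0 ≤ (1 - l) * ∑ i, (x i - m) / gg m l (x i) := by
  have hc : Continuous (fun l => ∏ i, gg m l (x i)) := by
    unfold gg; fun_prop
  obtain ⟨l, ⟨hl0, hl1⟩, hmax⟩ := (isCompact_Icc (a := (0:ℝ)) (b := 1)).exists_isMaxOn
    ⟨0, by simp⟩ hc.continuousOn
  have hge : 1 ≤ ∏ i, gg m l (x i) := by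
    have := hmax (show (0:ℝ) ∈ Set.Icc (0:ℝ) 1 by simp)
    simpa [gg] using this
  have hpos : ∀ i, 0 < gg m l (x i) := by
    intro i
    refine lt_of_le_of_ne (gg_nonneg hm1 hl0 hl1 (hx1 i)) ?_
    intro h
    have : ∏ i, gg m l (x i) = 0 := Finset.prod_eq_zero (Finset.mem_univ i) h.symm
    linarith
  have hloc : IsLocalMaxOn (fun l => ∑ i, Real.log (gg m l (x i))) (Set.Icc (0:ℝ) 1) l := by
    have hev : ∀ᶠ t in nhdsWithin l (Set.Icc (0:ℝ) 1), ∀ i, 0 < gg m t (x i) := by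
      apply Filter.Eventually.filter_mono nhdsWithin_le_nhds
      rw [Filter.eventually_all]
      intro i
      have : Continuous (fun t => gg m t (x i)) := by unfold gg; fun_prop
      exact this.continuousAt.eventually (lt_mem_nhds (hpos i))
    filter_upwards [hev, self_mem_nhdsWithin] with t ht htm
    rw [← Real.log_prod (fun i _ => (ht i).ne'), ← Real.log_prod (fun i _ => (hpos i).ne')]
    exact Real.log_le_log (Finset.prod_pos fun i _ => ht i) (hmax htm)
  have hder : HasDerivAt (fun l => ∑ i, Real.log (gg m l (x i)))
      (∑ i, (-((x i - m) / (1 - m))) / gg m l (x i)) l := by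
    apply HasDerivAt.fun_sum
    intro i _
    have hg : HasDerivAt (fun t => gg m t (x i)) (-((x i - m) / (1 - m))) l := by
      unfold gg
      simpa using ((hasDerivAt_id l).mul_const ((x i - m) / (1 - m))).const_sub 1
    exact HasDerivAt.log hg (hpos i).ne'
  have hsum : (∑ i, (-((x i - m) / (1 - m))) / gg m l (x i))
      = - (1 - m)⁻¹ * ∑ i, (x i - m) / gg m l (x i) := by
    rw [Finset.mul_sum]
    refine Finset.sum_congr rfl fun i _ => ?_
    have := (hpos i).ne'
    have : 1 - m ≠ 0 := by linarith
    field_simp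
  have key : ∀ y ∈ Set.Icc (0:ℝ) 1,
      (y - l) * (- (1 - m)⁻¹ * ∑ i, (x i - m) / gg m l (x i)) ≤ 0 := by
    intro y hy
    have h1 : y - l ∈ posTangentConeAt (Set.Icc (0:ℝ) 1) l :=
      sub_mem_posTangentConeAt_of_segment_subset
        ((convex_Icc (0:ℝ) 1).segment_subset ⟨hl0, hl1⟩ hy)
    have := hloc.hasFDerivWithinAt_nonpos hder.hasFDerivAt.hasFDerivWithinAt h1
    rw [hsum] at this
    simpa using this
  have hi : 0 < (1 - m)⁻¹ := by
    have : 0 < 1 - m := by linarith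
    positivity
  refine ⟨l, hl0, hl1, hpos, ?_, ?_⟩
  · have := key 0 (by simp)
    by_contra hcon
    push Not at hcon
    nlinarith [mul_pos hi hcon]
  · have := key 1 (by simp)
    by_contra hcon
    push Not at hcon
    nlinarith [mul_pos hi (neg_pos.mpr hcon)]

lemma sums {n : ℕ} (hn : 1 ≤ n) (x : Fin n → ℝ) {m l : ℝ} (hm1 : m < 1)
    (hpos : ∀ i, 0 < gg m l (x i)) :
    (∑ i, ((n : ℝ) * gg m l (x i))⁻¹
      = 1 + l / (1 - m) * ((n : ℝ)⁻¹ * ∑ i, (x i - m) / gg m l (x i))) ∧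
    (∑ i, ((n : ℝ) * gg m l (x i))⁻¹ * x i
      = (n : ℝ)⁻¹ * (∑ i, (x i - m) / gg m l (x i)) +
        m * (1 + l / (1 - m) * ((n : ℝ)⁻¹ * ∑ i, (x i - m) / gg m l (x i)))) := by
  have hn0 : (n : ℝ) ≠ 0 := by positivity
  have hm : 1 - m ≠ 0 := by linarith
  have h1 : ∑ i, ((n : ℝ) * gg m l (x i))⁻¹
      = 1 + l / (1 - m) * ((n : ℝ)⁻¹ * ∑ i, (x i - m) / gg m l (x i)) := by
    have : (1:ℝ) = ∑ i : Fin n, (n:ℝ)⁻¹ := by simp [hn0]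
    rw [this, Finset.mul_sum, Finset.mul_sum, ← Finset.sum_add_distrib]
    refine Finset.sum_congr rfl fun i _ => ?_
    rw [← this]
    have hg := (hpos i).ne'
    field_simp
    unfold gg
    field_simp
    ring
  refine ⟨h1, ?_⟩
  rw [← h1, Finset.mul_sum, Finset.mul_sum, ← Finset.sum_add_distrib]
  refine Finset.sum_congr rfl fun i _ => ?_
  have hg := (hpos i).ne'
  field_simp
  ring

lemma pinsker {m μ : ℝ} (hm0 : 0 < m) (hmμ : m ≤ μ) (hμ1 : μ < 1) :
    2 * (μ - m) ^ 2 ≤ (1 - m) * Real.log ((1 - m) / (1 - μ)) + m * Real.log (m / μ) := by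
  let f : ℝ → ℝ := fun t =>
    (1 - m) * (Real.log (1 - m) - Real.log (1 - t)) + m * (Real.log m - Real.log t)
      - 2 * (t - m) ^ 2
  have hd : ∀ t ∈ Set.Ico m 1, HasDerivAt f
      ((1 - m) * (0 - (-1) / (1 - t)) + m * (0 - 1 / t) - 2 * (2 * (t - m))) t := by
    intro t ht
    have h1 : (1 - t) ≠ 0 := by have := ht.2; linarith
    have h2 : t ≠ 0 := by have := ht.1; linarith
    have e1 : HasDerivAt (fun t : ℝ => Real.log (1 - t)) ((-1) / (1 - t)) t :=
      HasDerivAt.log (by simpa using (hasDerivAt_id t).const_sub 1) h1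
    have e2 : HasDerivAt (fun t : ℝ => Real.log t) (1 / t) t := by
      simpa using Real.hasDerivAt_log h2
    have e3 : HasDerivAt (fun t : ℝ => (t - m) ^ 2) (2 * (t - m)) t := by
      simpa using ((hasDerivAt_id t).sub_const m).fun_pow 2
    exact (((((hasDerivAt_const t (Real.log (1 - m))).sub e1).const_mul (1 - m)).add
      (((hasDerivAt_const t (Real.log m)).sub e2).const_mul m))).sub (e3.const_mul 2)
  have hmono : MonotoneOn f (Set.Icc m μ) := by
    apply monotoneOn_of_deriv_nonneg (convex_Icc m μ)
    · intro t ht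
      exact (hd t ⟨ht.1, by linarith [ht.2]⟩).continuousAt.continuousWithinAt
    · intro t ht
      rw [interior_Icc] at ht
      exact (hd t ⟨ht.1.le, by linarith [ht.2]⟩).differentiableAt.differentiableWithinAt
    · intro t ht
      rw [interior_Icc] at ht
      rw [(hd t ⟨ht.1.le, by linarith [ht.2]⟩).deriv]
      have h1 : 0 < 1 - t := by linarith [ht.2]
      have h2 : 0 < t := by linarith [ht.1]
      have : (1 - m) * (0 - (-1) / (1 - t)) + m * (0 - 1 / t) - 2 * (2 * (t - m))
          = (t - m) * (1 - 2 * t) ^ 2 / (t * (1 - t)) := by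
        field_simp; ring
      rw [this]
      have : 0 < t - m := by linarith [ht.1]
      positivity
  have := hmono ⟨le_refl m, hmμ⟩ ⟨hmμ, le_refl μ⟩ hmμ
  simp only [f] at this
  rw [Real.log_div (by linarith) (by linarith), Real.log_div (by linarith) (by linarith)]
  linarith

/-- two-point concavity of the logarithm -/
lemma log_two {c d α β : ℝ} (hc : 0 ≤ c) (hd : 0 ≤ d) (hcd : 0 < c + d) (hα : 0 < α)
    (hβ : 0 < β) :
    (c * Real.log α + d * Real.log β) / (c + d) ≤
      Real.log (c * α + d * β) - Real.log (c + d) := by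
  have h := strictConcaveOn_log_Ioi.concaveOn.2 (Set.mem_Ioi.2 hα) (Set.mem_Ioi.2 hβ)
    (show 0 ≤ c / (c + d) by positivity) (show 0 ≤ d / (c + d) by positivity) (by field_simp)
  simp only [smul_eq_mul] at h
  have hp : 0 < c * α + d * β := by
    rcases hc.eq_or_lt with h0 | h0
    · have : 0 < d := by linarith
      subst h0; simp; positivity
    · positivity
  rw [← Real.log_div hp.ne' hcd.ne']
  have q1 : c / (c + d) * Real.log α + d / (c + d) * Real.log β
      = (c * Real.log α + d * Real.log β) / (c + d) := by ring
  have q2 : c / (c + d) * α + d / (c + d) * β = (c * α + d * β) / (c + d) := by ring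
  rwa [q1, q2] at h

lemma regularity {n : ℕ} (hn : 1 ≤ n) (x : Fin n → ℝ) (hx0 : ∀ i, 0 ≤ x i) (hx1 : ∀ i, x i ≤ 1)
    {m μ l : ℝ} (hm0 : 0 < m) (hmμ : m < μ) (hμ1 : μ < 1) (hl0 : 0 ≤ l) (hl1 : l ≤ 1)
    (hpos : ∀ i, 0 < gg m l (x i))
    (hD1 : l * ∑ i, (x i - m) / gg m l (x i) ≤ 0)
    (hD0 : (1 - l) * ∑ i, (x i - m) / gg m l (x i) = 0) :
    ∃ l' : ℝ, 0 ≤ l' ∧ l' ≤ 1 ∧ (∀ i, 0 < gg μ l' (x i)) ∧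
      (∑ i, Real.log (gg m l (x i))) + n * (2 * (μ - m) ^ 2) ≤
        ∑ i, Real.log (gg μ l' (x i)) := by
  have hm1 : m < 1 := by linarith
  have hnR : (0:ℝ) < n := by positivity
  obtain ⟨s1, s2⟩ := sums hn x hm1 hpos
  set D := ∑ i, (x i - m) / gg m l (x i) with hD
  set α := (1 - m) / (1 - μ) with hα
  set β := m / μ with hβ
  have hμ0 : 0 < μ := by linarith
  have hαpos : 0 < α := div_pos (by linarith) (by linarith)
  have hβpos : 0 < β := by positivity
  have hα1 : 1 ≤ α := by rw [hα, one_le_div (by linarith)]; linarith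
  have hβ1 : β ≤ 1 := by rw [hβ, div_le_one hμ0]; linarith
  set a := 1 + l * m / (1 - m) with ha
  set b := 1 - l with hb
  have hb0 : 0 ≤ b := by linarith
  have hb1 : b ≤ 1 := by linarith
  have ha0 : 0 < a := by
    have : 0 ≤ l * m / (1 - m) := div_nonneg (by positivity) (by linarith)
    linarith
  have hm' : 1 - m ≠ 0 := by linarith
  have hμ' : 1 - μ ≠ 0 := by linarith
  have g1 : ∀ y, gg m l y = (1 - y) * a + y * b := by
    intro y; rw [ha, hb]; unfold gg; field_simp; ring
  have g2 : ∀ y, gg μ (1 - b * β) y = (1 - y) * a * α + y * b * β := by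
    intro y; rw [ha, hb, hα, hβ]; unfold gg; field_simp; ring
  have hbβ : b * β ≤ 1 := by nlinarith
  have hp : ∀ i, 0 < gg μ (1 - b * β) (x i) := by
    intro i
    rw [g2]
    have h := hpos i
    rw [g1] at h
    have h1 : 0 ≤ (1 - x i) * a := mul_nonneg (by linarith [hx1 i]) ha0.le
    have h2 : 0 ≤ x i * b := mul_nonneg (hx0 i) hb0
    rcases h1.eq_or_lt with h0 | h0
    · have : 0 < x i * b := by linarith
      rw [← h0]; simp; positivity
    · positivity
  refine ⟨1 - b * β, by linarith, by nlinarith [mul_nonneg hb0 hβpos.le], hp, ?_⟩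
  have step : ∀ i, ((1 - x i) * a * Real.log α + x i * b * Real.log β) / gg m l (x i) ≤
      Real.log (gg μ (1 - b * β) (x i)) - Real.log (gg m l (x i)) := by
    intro i
    have h := hpos i
    rw [g2, g1]
    rw [g1] at h
    exact log_two (mul_nonneg (by linarith [hx1 i]) ha0.le) (mul_nonneg (hx0 i) hb0) h hαpos hβpos
  have hsum := Finset.sum_le_sum (s := Finset.univ) fun i _ => step i
  rw [Finset.sum_sub_distrib] at hsum
  have hL : ∑ i, ((1 - x i) * a * Real.log α + x i * b * Real.log β) / gg m l (x i)
      = n * (a * Real.log α * (∑ i, ((n : ℝ) * gg m l (x i))⁻¹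
          - ∑ i, ((n : ℝ) * gg m l (x i))⁻¹ * x i)
        + b * Real.log β * ∑ i, ((n : ℝ) * gg m l (x i))⁻¹ * x i) := by
    rw [← Finset.sum_sub_distrib, Finset.mul_sum, Finset.mul_sum, ← Finset.sum_add_distrib,
      Finset.mul_sum]
    refine Finset.sum_congr rfl fun i _ => ?_
    have hg := (hpos i).ne'
    field_simp
  have e1 : ∑ i, ((n : ℝ) * gg m l (x i))⁻¹ - ∑ i, ((n : ℝ) * gg m l (x i))⁻¹ * x i = 1 - m := by
    rw [s2, s1]
    have : l * D = D := by linarith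
    field_simp
    linear_combination (1 - m) * this
  have e2 : b * ∑ i, ((n : ℝ) * gg m l (x i))⁻¹ * x i = b * m := by
    rw [s2]
    linear_combination (((n:ℝ)⁻¹) + m * l / (1 - m) * (n:ℝ)⁻¹) * hD0
  have e3 : a * (1 - m) = 1 - b * m := by
    rw [ha, hb]; field_simp; ring
  rw [hL, e1] at hsum
  have e4 : a * Real.log α * (1 - m) + b * Real.log β * ∑ i, ((n : ℝ) * gg m l (x i))⁻¹ * x i
      = (1 - b * m) * Real.log α + b * m * Real.log β := by
    linear_combination Real.log α * e3 + Real.log β * e2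
  rw [e4] at hsum
  have hpk := pinsker hm0 hmμ.le hμ1
  rw [← hα, ← hβ] at hpk
  have l1 : 0 ≤ Real.log α := Real.log_nonneg hα1
  have l2 : Real.log β ≤ 0 := Real.log_nonpos hβpos.le hβ1
  have hbm : b * m ≤ m := by nlinarith
  have : 2 * (μ - m) ^ 2 ≤ (1 - b * m) * Real.log α + b * m * Real.log β := by
    nlinarith [mul_nonneg (sub_nonneg.2 hbm) l1, mul_nonneg (sub_nonneg.2 hbm) (neg_nonneg.2 l2)]
  have := mul_le_mul_of_nonneg_left this hnR.le
  linarith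

lemma KL_le {n : ℕ} (hn : 1 ≤ n) (x : Fin n → ℝ) (hx0 : ∀ i, 0 ≤ x i) (hx1 : ∀ i, x i ≤ 1)
    {m l : ℝ} (hm1 : m < 1) (hl0 : 0 ≤ l) (hl1 : l ≤ 1)
    (hpos : ∀ i, 0 < gg m l (x i))
    (hD1 : l * ∑ i, (x i - m) / gg m l (x i) ≤ 0)
    (hD0 : 0 ≤ (1 - l) * ∑ i, (x i - m) / gg m l (x i)) :
    ∃ ν' : Measure ℝ, IsProbabilityMeasure ν' ∧ ν' (Set.Icc (0:ℝ) 1)ᶜ = 0 ∧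
      m ≤ ∫ y, y ∂ν' ∧
      KL ((n : ℝ≥0∞)⁻¹ • ∑ i : Fin n, Measure.dirac (x i)) ν' ≤
        ENNReal.ofReal ((n : ℝ)⁻¹ * ∑ i, Real.log (gg m l (x i))) := by
  obtain ⟨s1, s2⟩ := sums hn x hm1 hpos
  have hnR : (0:ℝ) < n := by positivity
  have hm' : 0 < 1 - m := by linarith
  set D := ∑ i, (x i - m) / gg m l (x i) with hD
  set w : Fin n → ℝ := fun i => ((n : ℝ) * gg m l (x i))⁻¹ with hw
  have hw0 : ∀ i, 0 ≤ w i := fun i => by have := hpos i; simp only [hw]; positivity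
  set r : ℝ := 1 - ∑ i, w i with hr
  have hr' : r = - ((n:ℝ)⁻¹ / (1 - m) * (l * D)) := by
    rw [hr, s1]; ring
  have hr0 : 0 ≤ r := by
    rw [hr', neg_nonneg]
    exact mul_nonpos_of_nonneg_of_nonpos (by positivity) hD1
  have hrl : r * (1 - l) = 0 := by
    have : l * D * (1 - l) = 0 := by
      apply le_antisymm
      · exact mul_nonpos_of_nonpos_of_nonneg hD1 (by linarith)
      · have := mul_nonneg hl0 hD0
        linarith
    rw [hr']
    linear_combination - ((n:ℝ)⁻¹ / (1 - m)) * this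
  have hg1 : gg m l 1 = 1 - l := by
    unfold gg; field_simp
  set ν' : Measure ℝ := (∑ i, ENNReal.ofReal (w i) • Measure.dirac (x i))
    + ENNReal.ofReal r • Measure.dirac 1 with hν'
  have hprob : IsProbabilityMeasure ν' := by
    constructor
    simp only [hν', Measure.add_apply, Measure.finsetSum_apply, Measure.smul_apply, measure_univ,
      smul_eq_mul, mul_one]
    rw [← ENNReal.ofReal_sum_of_nonneg (fun i _ => hw0 i),
      ← ENNReal.ofReal_add (Finset.sum_nonneg fun i _ => hw0 i) hr0]
    simp [hr]
  have hsupp : ν' (Set.Icc (0:ℝ) 1)ᶜ = 0 := by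
    have hmeas : MeasurableSet (Set.Icc (0:ℝ) 1)ᶜ := measurableSet_Icc.compl
    simp only [hν', Measure.add_apply, Measure.finsetSum_apply, Measure.smul_apply, smul_eq_mul,
      Measure.dirac_apply' _ hmeas]
    simp [hx0, hx1]
  have hintd : ∀ (f : ℝ → ℝ) (a : ℝ), Integrable f (Measure.dirac a) := fun f a =>
    integrable_dirac (by simp)
  have hmean : ∫ y, y ∂ν' = (∑ i, w i * x i) + r := by
    rw [hν', integral_add_measure, integral_finsetSum_measure]
    · simp [integral_smul_measure, hr0, hw0]
    · intro i _
      exact (hintd _ _).smul_measure (by simp)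
    · exact integrable_finsetSum_measure.2 fun i _ => (hintd _ _).smul_measure (by simp)
    · exact (hintd _ _).smul_measure (by simp)
  refine ⟨ν', hprob, hsupp, ?_, ?_⟩
  · rw [hmean, s2, hr']
    have : (n:ℝ)⁻¹ * D + m * (1 + l / (1 - m) * ((n:ℝ)⁻¹ * D)) + -((n:ℝ)⁻¹ / (1 - m) * (l * D))
        = m + (n:ℝ)⁻¹ * ((1 - l) * D) := by
      field_simp; ring
    rw [this]
    have : 0 ≤ (n:ℝ)⁻¹ * ((1 - l) * D) := by positivity
    linarith
  · set e : Measure ℝ := (n : ℝ≥0∞)⁻¹ • ∑ i : Fin n, Measure.dirac (x i) with he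
    have hgm : Measurable (fun y => ENNReal.ofReal (gg m l y)) := by
      unfold gg; fun_prop
    have hdens : e = ν'.withDensity (fun y => ENNReal.ofReal (gg m l y)) := by
      have hadd : ν'.withDensity (fun y => ENNReal.ofReal (gg m l y)) =
          (∑ i, ENNReal.ofReal (w i) • ENNReal.ofReal (gg m l (x i)) • Measure.dirac (x i))
          + ENNReal.ofReal r • ENNReal.ofReal (gg m l 1) • Measure.dirac 1 := by
        rw [hν', withDensity_add_measure, withDensity_smul_measure, dirac_withDensity,
          ← Measure.sum_fintype, withDensity_sum, Measure.sum_fintype]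
        simp only [withDensity_smul_measure, dirac_withDensity]
      rw [hadd, smul_smul, ← ENNReal.ofReal_mul hr0, hg1, hrl, ENNReal.ofReal_zero, zero_smul,
        add_zero, he, Finset.smul_sum]
      refine Finset.sum_congr rfl fun i _ => ?_
      rw [smul_smul, ← ENNReal.ofReal_mul (hw0 i)]
      congr 1
      have : w i * gg m l (x i) = (n:ℝ)⁻¹ := by
        simp only [hw]
        have := (hpos i).ne'
        field_simp
      rw [this, ENNReal.ofReal_inv_of_pos hnR]
      simp
    have hac : e ≪ ν' := by
      rw [hdens]; exact withDensity_absolutelyContinuous _ _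
    have hrn : e.rnDeriv ν' =ᵐ[e] fun y => ENNReal.ofReal (gg m l y) := by
      apply hac.ae_le
      nth_rewrite 1 [hdens]
      exact Measure.rnDeriv_withDensity ν' hgm
    have hae : (fun y => Real.log ((e.rnDeriv ν' y).toReal)) =ᵐ[e]
        fun y => Real.log (ENNReal.ofReal (gg m l y)).toReal := by
      filter_upwards [hrn] with y hy
      rw [hy]
    have hn' : ((n : ℝ≥0∞)⁻¹) ≠ ⊤ := by
      simp; omega
    have hIntg : Integrable (fun y => Real.log (ENNReal.ofReal (gg m l y)).toReal) e := by
      rw [he]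
      exact (integrable_finsetSum_measure.2 fun i _ => hintd _ _).smul_measure hn'
    have hval : ∫ y, Real.log (ENNReal.ofReal (gg m l y)).toReal ∂e
        = (n : ℝ)⁻¹ * ∑ i, Real.log (gg m l (x i)) := by
      rw [he, integral_smul_measure, integral_finsetSum_measure fun i _ => hintd _ _]
      simp only [integral_dirac, ENNReal.toReal_inv, ENNReal.toReal_natCast, smul_eq_mul]
      congr 1
      refine Finset.sum_congr rfl fun i _ => ?_
      rw [ENNReal.toReal_ofReal (hpos i).le]
    unfold KL
    rw [if_pos ⟨hac, hIntg.congr hae.symm⟩, integral_congr_ae hae, hval]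

/-- Deterministic core. -/
lemma det_core {n : ℕ} (hn : 1 ≤ n) (x : Fin n → ℝ) (hx0 : ∀ i, 0 ≤ x i) (hx1 : ∀ i, x i ≤ 1)
    {m μ ε : ℝ} (hm0 : 0 < m) (hmμ : m < μ) (hμ1 : μ < 1) (hε : 0 < ε)
    (h : ∀ ν' : Measure ℝ, IsProbabilityMeasure ν' → ν' (Set.Icc (0:ℝ) 1)ᶜ = 0 →
      m ≤ ∫ y, y ∂ν' →
      ENNReal.ofReal ε < KL ((n : ℝ≥0∞)⁻¹ • ∑ i : Fin n, Measure.dirac (x i)) ν') :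
    ∃ l' : ℝ, 0 ≤ l' ∧ l' ≤ 1 ∧
      Real.exp (n * (ε + 2 * (μ - m) ^ 2)) ≤ ∏ i, gg μ l' (x i) := by
  have hm1 : m < 1 := by linarith
  have hnR : (0:ℝ) < n := by positivity
  obtain ⟨l, hl0, hl1, hpos, hD1, hD0⟩ := opt_exists x hx1 hm1
  obtain ⟨ν', h1, h2, h3, h4⟩ := KL_le hn x hx0 hx1 hm1 hl0 hl1 hpos hD1 hD0
  have h5 := (h ν' h1 h2 h3).trans_le h4
  rw [ENNReal.ofReal_lt_ofReal_iff_of_nonneg hε.le] at h5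
  have h6 : n * ε ≤ ∑ i, Real.log (gg m l (x i)) := by
    have := mul_le_mul_of_nonneg_left h5.le hnR.le
    rwa [mul_inv_cancel_left₀ hnR.ne'] at this
  have hl : 0 < l := by
    rcases hl0.eq_or_lt with h0 | h0
    · subst h0
      simp [gg] at h6
      nlinarith
    · exact h0
  have hD0' : (1 - l) * ∑ i, (x i - m) / gg m l (x i) = 0 := by
    apply le_antisymm _ hD0
    apply mul_nonpos_of_nonneg_of_nonpos (by linarith)
    by_contra hc
    push Not at hc
    have := mul_pos hl hc
    linarith
  obtain ⟨l', a1, a2, a3, a4⟩ := regularity hn x hx0 hx1 hm0 hmμ hμ1 hl0 hl1 hpos hD1 hD0'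
  refine ⟨l', a1, a2, ?_⟩
  rw [← Real.le_log_iff_exp_le (Finset.prod_pos fun i _ => a3 i),
    Real.log_prod (fun i _ => (a3 i).ne')]
  linarith

/-- Passing to a grid of `n + 1` values. -/
lemma grid {n : ℕ} (hn : 1 ≤ n) (x : Fin n → ℝ) (hx1 : ∀ i, x i ≤ 1)
    {μ l : ℝ} (hμ1 : μ < 1) (hl0 : 0 ≤ l) (hl1 : l ≤ 1) :
    ∏ i, gg μ l (x i) ≤
      Real.exp 1 * ∑ k ∈ Finset.range (n + 1), ∏ i, gg μ ((k : ℝ) / (n + 1)) (x i) := by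
  have hnR : (0:ℝ) < n := by positivity
  have hpr : ∀ k ∈ Finset.range (n + 1), 0 ≤ ∏ i, gg μ ((k : ℝ) / (n + 1)) (x i) := by
    intro k hk
    refine Finset.prod_nonneg fun i _ => gg_nonneg hμ1 (by positivity) ?_ (hx1 i)
    rw [div_le_one (by positivity)]
    have : (k:ℝ) < ((n + 1 : ℕ) : ℝ) := by exact_mod_cast Finset.mem_range.1 hk
    push_cast at this
    exact this.le
  set k := ⌈(n:ℝ) * l⌉₊ with hk
  have hk1 : (n:ℝ) * l ≤ k := Nat.le_ceil _
  have hk2 : (k:ℝ) < n * l + 1 := Nat.ceil_lt_add_one (by positivity)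
  have hkn : k ∈ Finset.range (n + 1) := by
    rw [Finset.mem_range, Nat.lt_succ_iff]
    apply Nat.ceil_le.2
    nlinarith
  have hle : ∀ i, (n:ℝ) / (n + 1) * gg μ l (x i) ≤ gg μ ((k : ℝ) / (n + 1)) (x i) := by
    intro i
    have hz : (x i - μ) / (1 - μ) ≤ 1 := by
      rw [div_le_one (by linarith)]; linarith [hx1 i]
    have : gg μ ((k : ℝ) / (n + 1)) (x i) - (n:ℝ) / (n + 1) * gg μ l (x i)
        = (1 - (k - n * l) * ((x i - μ) / (1 - μ))) / (n + 1) := by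
      unfold gg
      generalize (x i - μ) / (1 - μ) = z
      field_simp
      ring
    have h2 : 0 ≤ (1 - (k - n * l) * ((x i - μ) / (1 - μ))) / (n + 1) := by
      apply div_nonneg _ (by positivity)
      nlinarith
    linarith
  have hprod : ((n:ℝ) / (n + 1)) ^ n * ∏ i, gg μ l (x i) ≤ ∏ i, gg μ ((k : ℝ) / (n + 1)) (x i) := by
    have := Finset.prod_le_prod (s := Finset.univ)
      (fun i _ => mul_nonneg (by positivity) (gg_nonneg hμ1 hl0 hl1 (hx1 i))) (fun i _ => hle i)
    rwa [Finset.prod_mul_distrib, Finset.prod_const, Finset.card_univ, Fintype.card_fin] at this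
  have hs : ∏ i, gg μ ((k : ℝ) / (n + 1)) (x i) ≤
      ∑ k ∈ Finset.range (n + 1), ∏ i, gg μ ((k : ℝ) / (n + 1)) (x i) :=
    Finset.single_le_sum hpr hkn
  have hp0 : 0 ≤ ∏ i, gg μ l (x i) := Finset.prod_nonneg fun i _ => gg_nonneg hμ1 hl0 hl1 (hx1 i)
  have hexp : 1 ≤ Real.exp 1 * ((n:ℝ) / (n + 1)) ^ n := by
    have h1 : (((n:ℝ) + 1) / n) ^ n ≤ Real.exp 1 := by
      have h2 : ((n:ℝ) + 1) / n ≤ Real.exp ((n:ℝ)⁻¹) := by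
        have := Real.add_one_le_exp ((n:ℝ)⁻¹)
        have h3 : ((n:ℝ) + 1) / n = (n:ℝ)⁻¹ + 1 := by field_simp; ring
        linarith
      calc (((n:ℝ) + 1) / n) ^ n ≤ (Real.exp ((n:ℝ)⁻¹)) ^ n := by gcongr
        _ = Real.exp 1 := by rw [← Real.exp_nat_mul, mul_inv_cancel₀ hnR.ne']
    calc (1:ℝ) = (((n:ℝ) + 1) / n) ^ n * ((n:ℝ) / (n + 1)) ^ n := by
          rw [← mul_pow]
          have : ((n:ℝ) + 1) / n * (n / (n + 1)) = 1 := by field_simp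
          rw [this, one_pow]
      _ ≤ _ := by gcongr
  calc ∏ i, gg μ l (x i) ≤ (Real.exp 1 * ((n:ℝ) / (n + 1)) ^ n) * ∏ i, gg μ l (x i) :=
        le_mul_of_one_le_left hp0 hexp
    _ = Real.exp 1 * (((n:ℝ) / (n + 1)) ^ n * ∏ i, gg μ l (x i)) := by ring
    _ ≤ _ := by gcongr; exact hprod.trans hs

/-- Pointwise bound. -/
lemma pointwise {n : ℕ} (hn : 1 ≤ n) (x : Fin n → ℝ) (hx0 : ∀ i, 0 ≤ x i) (hx1 : ∀ i, x i ≤ 1)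
    {μ ε : ℝ} (hμ1 : μ < 1) (hε : 0 < ε) :
    μ - sSup {m : ℝ | m ∈ Set.Icc (0:ℝ) 1 ∧
        Kinf ((n : ℝ≥0∞)⁻¹ • ∑ i : Fin n, Measure.dirac (x i)) m ≤ ENNReal.ofReal ε}
      ≤ (Real.exp (-(n * ε)) * Real.sqrt (π / n)) *
        ∑ k ∈ Finset.range (n + 1), ∏ i, gg μ ((k : ℝ) / (n + 1)) (x i) := by
  have hnR : (0:ℝ) < n := by positivity
  have hS0 : 0 ≤ ∑ k ∈ Finset.range (n + 1), ∏ i, gg μ ((k : ℝ) / (n + 1)) (x i) := by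
    refine Finset.sum_nonneg fun k hk => ?_
    refine Finset.prod_nonneg fun i _ => gg_nonneg hμ1 (by positivity) ?_ (hx1 i)
    rw [div_le_one (by positivity)]
    have : (k:ℝ) < ((n + 1 : ℕ) : ℝ) := by exact_mod_cast Finset.mem_range.1 hk
    push_cast at this
    exact this.le
  set S := ∑ k ∈ Finset.range (n + 1), ∏ i, gg μ ((k : ℝ) / (n + 1)) (x i) with hS
  set A := {m : ℝ | m ∈ Set.Icc (0:ℝ) 1 ∧
        Kinf ((n : ℝ≥0∞)⁻¹ • ∑ i : Fin n, Measure.dirac (x i)) m ≤ ENNReal.ofReal ε} with hA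
  set U := sSup A with hU
  have hbdd : BddAbove A := ⟨1, fun m hm => hm.1.2⟩
  have hU0 : 0 ≤ U := Real.sSup_nonneg fun m hm => hm.1.1
  by_cases hlt : U < μ
  swap
  · push Not at hlt
    have : 0 ≤ (Real.exp (-(n * ε)) * Real.sqrt (π / n)) * S := by positivity
    linarith
  have key : ∀ m' ∈ Set.Ioo U μ, Real.exp (n * (ε + 2 * (μ - m') ^ 2)) ≤ Real.exp 1 * S := by
    intro m' hm'
    obtain ⟨m, hm⟩ := exists_between hm'.1
    have hnot : m ∉ A := fun hmem => absurd (le_csSup hbdd hmem) (not_le.2 hm.1)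
    have hK : ENNReal.ofReal ε <
        Kinf ((n : ℝ≥0∞)⁻¹ • ∑ i : Fin n, Measure.dirac (x i)) m := by
      by_contra hcon
      push Not at hcon
      exact hnot ⟨⟨by linarith [hm.1], by linarith [hm.2, hm'.2]⟩, hcon⟩
    obtain ⟨l', a1, a2, a3⟩ := det_core hn x hx0 hx1 (m := m') (μ := μ) (ε := ε)
      (by linarith [hm'.1]) hm'.2 hμ1 hε (by
        intro ν' b1 b2 b3
        refine hK.trans_le ?_
        unfold Kinf
        exact iInf_le_of_le ν' (iInf_le_of_le b1 (iInf_le_of_le b2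
          (iInf_le_of_le (by linarith [hm.2]) le_rfl))))
    exact a3.trans (grid hn x hx1 hμ1 a1 a2)
  have keyU : Real.exp (n * (ε + 2 * (μ - U) ^ 2)) ≤ Real.exp 1 * S := by
    have hcont : Continuous fun m' : ℝ => Real.exp (n * (ε + 2 * (μ - m') ^ 2)) := by fun_prop
    have ht : Filter.Tendsto (fun m' : ℝ => Real.exp (n * (ε + 2 * (μ - m') ^ 2)))
        (nhdsWithin U (Set.Ioi U)) (nhds (Real.exp (n * (ε + 2 * (μ - U) ^ 2)))) :=
      (hcont.tendsto U).mono_left nhdsWithin_le_nhds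
    refine le_of_tendsto ht ?_
    filter_upwards [Ioo_mem_nhdsGT hlt] with m' hm' using key m' hm'
  set T := μ - U with hT
  have hT0 : 0 < T := by linarith
  have hexp : Real.exp (n * (ε + 2 * T ^ 2)) = Real.exp (n * ε) * Real.exp (2 * n * T ^ 2) := by
    rw [← Real.exp_add]; ring_nf
  have hq : 2 * n * T ^ 2 + 1 ≤ Real.exp (2 * n * T ^ 2) := Real.add_one_le_exp _
  set s := Real.sqrt n with hs
  have hs0 : 0 < s := Real.sqrt_pos.2 hnR
  have hss : s ^ 2 = n := Real.sq_sqrt hnR.le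
  have hqq : 2.8 * (s * T) ≤ Real.exp (2 * n * T ^ 2) := by
    refine le_trans ?_ hq
    rw [← hss]
    nlinarith [sq_nonneg (s * T - 0.7)]
  have he : Real.exp 1 ≤ 2.8 := by linarith [Real.exp_one_lt_d9]
  have hpi : 1 ≤ Real.sqrt π := Real.one_le_sqrt.2 (by linarith [Real.pi_gt_three])
  have hTS : s * T ≤ Real.exp (-(n * ε)) * S := by
    have h1 : Real.exp (n * ε) * (2.8 * (s * T)) ≤ 2.8 * S :=
      calc Real.exp (n * ε) * (2.8 * (s * T)) ≤ Real.exp (n * ε) * Real.exp (2 * n * T ^ 2) := by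
            gcongr
        _ ≤ Real.exp 1 * S := by rw [← hexp]; exact keyU
        _ ≤ 2.8 * S := by gcongr
    rw [Real.exp_neg, inv_mul_eq_div, le_div_iff₀ (Real.exp_pos _)]
    linarith
  rw [Real.sqrt_div Real.pi_pos.le, ← hs]
  have h2 : T ≤ Real.exp (-(n * ε)) * S / s := by
    rw [le_div_iff₀ hs0]; linarith
  have h3 : 0 ≤ Real.exp (-(n * ε)) * S / s := by positivity
  calc T ≤ Real.exp (-(n * ε)) * S / s := h2
    _ ≤ Real.exp (-(n * ε)) * S / s * Real.sqrt π := le_mul_of_one_le_right h3 hpi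
    _ = _ := by ring

/-- Integrated deviations for `K_inf`: with `U_{ε,n} = sup{μ ∈ [0,1] : K_inf(ν̂_n, μ) ≤ ε}`,
one has `E[(E(ν) − U_{ε,n})⁺] ≤ (2n+1) e^{−nε} √(π/n)`. -/
theorem kinf_integrated_deviation {Ω : Type*} [MeasurableSpace Ω]
    (P : Measure Ω) [IsProbabilityMeasure P]
    (ν : Measure ℝ) [IsProbabilityMeasure ν] (hsupp : ν (Set.Icc (0:ℝ) 1)ᶜ = 0)
    (hmean : (∫ y, y ∂ν) ∈ Set.Ioo (0:ℝ) 1)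
    (n : ℕ) (hn : 1 ≤ n) (X : Fin n → Ω → ℝ) (hmeas : ∀ i, Measurable (X i))
    (hindep : iIndepFun X P)
    (hdist : ∀ i, Measure.map (X i) P = ν)
    (ε : ℝ) (hε : 0 < ε) :
    ∫⁻ ω, ENNReal.ofReal ((∫ y, y ∂ν) -
        sSup {m : ℝ | m ∈ Set.Icc (0:ℝ) 1 ∧ Kinf (emp X ω) m ≤ ENNReal.ofReal ε}) ∂P
      ≤ ENNReal.ofReal ((2 * n + 1) * Real.exp (-(n * ε)) * Real.sqrt (π / n)) := by
  have hnR : (0:ℝ) < n := by positivity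
  obtain ⟨hμ0, hμ1⟩ := hmean
  set μ := ∫ y, y ∂ν with hμ
  have hae : ∀ᵐ y ∂ν, y ∈ Set.Icc (0:ℝ) 1 := by
    rw [ae_iff]; exact hsupp
  have hIntg : Integrable (fun y : ℝ => y) ν := by
    refine Integrable.of_bound measurable_id.aestronglyMeasurable 1 ?_
    filter_upwards [hae] with y hy
    rw [Real.norm_eq_abs, abs_le]
    exact ⟨by linarith [hy.1], hy.2⟩
  have hXae : ∀ᵐ ω ∂P, ∀ i, X i ω ∈ Set.Icc (0:ℝ) 1 := by
    rw [ae_all_iff]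
    intro i
    have h := hae
    rw [← hdist i] at h
    exact ae_of_ae_map (hmeas i).aemeasurable h
  have hgm : ∀ l : ℝ, Measurable (fun y => ENNReal.ofReal (gg μ l y)) := by
    intro l; unfold gg; fun_prop
  have hone : ∀ l : ℝ, 0 ≤ l → l ≤ 1 → ∫⁻ y, ENNReal.ofReal (gg μ l y) ∂ν = 1 := by
    intro l hl0 hl1
    have hgi : Integrable (fun y => gg μ l y) ν := by
      unfold gg
      exact (integrable_const 1).sub
        (((hIntg.sub (integrable_const μ)).div_const (1 - μ)).const_mul l)
    rw [← ofReal_integral_eq_lintegral_ofReal hgi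
      (by filter_upwards [hae] with y hy using gg_nonneg hμ1 hl0 hl1 hy.2)]
    have : ∫ y, gg μ l y ∂ν = 1 := by
      unfold gg
      have hi2 : Integrable (fun y : ℝ => l * ((y - μ) / (1 - μ))) ν :=
        ((hIntg.sub (integrable_const μ)).div_const (1 - μ)).const_mul l
      rw [integral_sub (integrable_const 1) hi2, integral_const_mul, integral_div, integral_sub hIntg (integrable_const μ)]
      simp [← hμ]
    rw [this, ENNReal.ofReal_one]
  have hgrid : ∀ k ∈ Finset.range (n + 1), 0 ≤ (k:ℝ) / (n + 1) ∧ (k:ℝ) / (n + 1) ≤ 1 := by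
    intro k hk
    refine ⟨by positivity, ?_⟩
    rw [div_le_one (by positivity)]
    have : (k:ℝ) < ((n + 1 : ℕ) : ℝ) := by exact_mod_cast Finset.mem_range.1 hk
    push_cast at this
    exact this.le
  have hprod : ∀ l : ℝ, 0 ≤ l → l ≤ 1 →
      ∫⁻ ω, ∏ i, ENNReal.ofReal (gg μ l (X i ω)) ∂P = 1 := by
    intro l hl0 hl1
    have hind : iIndepFun (fun i ω => ENNReal.ofReal (gg μ l (X i ω))) P :=
      hindep.comp (fun _ y => ENNReal.ofReal (gg μ l y)) (fun _ => hgm l)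
    rw [lintegral_prod_eq_prod_lintegral_of_indepFun Finset.univ
      (fun i ω => ENNReal.ofReal (gg μ l (X i ω))) hind (fun i => (hgm l).comp (hmeas i))]
    refine Finset.prod_eq_one fun i _ => ?_
    rw [← lintegral_map (hgm l) (hmeas i), hdist i]
    exact hone l hl0 hl1
  set C := Real.exp (-(n * ε)) * Real.sqrt (π / n) with hC
  have hC0 : 0 ≤ C := by positivity
  calc _ ≤ ∫⁻ ω, ENNReal.ofReal C * ∑ k ∈ Finset.range (n + 1),
          ∏ i, ENNReal.ofReal (gg μ ((k:ℝ) / (n + 1)) (X i ω)) ∂P := by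
        apply lintegral_mono_ae
        filter_upwards [hXae] with ω hω
        refine (ENNReal.ofReal_le_ofReal (pointwise hn (fun i => X i ω) (fun i => (hω i).1)
          (fun i => (hω i).2) hμ1 hε)).trans ?_
        rw [ENNReal.ofReal_mul hC0, ENNReal.ofReal_sum_of_nonneg]
        · gcongr with k hk
          rw [ENNReal.ofReal_prod_of_nonneg]
          intro i _
          exact gg_nonneg hμ1 (hgrid k hk).1 (hgrid k hk).2 (hω i).2
        · intro k hk
          exact Finset.prod_nonneg fun i _ =>
            gg_nonneg hμ1 (hgrid k hk).1 (hgrid k hk).2 (hω i).2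
    _ = ENNReal.ofReal C * ∑ k ∈ Finset.range (n + 1), 1 := by
        have hm : ∀ l : ℝ, Measurable (fun ω => ∏ i, ENNReal.ofReal (gg μ l (X i ω))) :=
          fun l => Finset.measurable_fun_prod _ fun i _ => (hgm l).comp (hmeas i)
        rw [lintegral_const_mul _ (Finset.measurable_fun_sum _ fun k _ => hm _),
          lintegral_finsetSum _ fun k _ => hm _]
        congr 1
        refine Finset.sum_congr rfl fun k hk => ?_
        exact hprod _ (hgrid k hk).1 (hgrid k hk).2
    _ = ENNReal.ofReal (C * (n + 1)) := by
        rw [ENNReal.ofReal_mul hC0]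
        congr 1
        have : ((n:ℝ) + 1) = ((n + 1 : ℕ) : ℝ) := by push_cast; ring
        rw [this, ENNReal.ofReal_natCast]
        simp
    _ ≤ _ := by
        apply ENNReal.ofReal_le_ofReal
        have : (2 * (n:ℝ) + 1) * Real.exp (-(n * ε)) * Real.sqrt (π / n) = C * (2 * n + 1) := by
          rw [hC]; ring
        rw [this]
        gcongr
        linarith
end

section
/- Let X_1, …, X_n be i.i.d. random variables with distribution ν on [0,1], let ν̂_n = (1/n) Σ_{i=1}^n δ_{X_i} be their empirical distribution, let μ ∈ (E(ν), 1), and set γ = (1/√(1 − μ)) (16 e^{−2} + ln²(1/(1 − μ))). Then γ ≥ 2, and for all real x < K_inf(ν, μ): if x ≤ K_inf(ν, μ) − γ/2 then P[ K_inf(ν̂_n, μ) ≤ x ] ≤ exp(−n γ / 8) ≤ exp(−n/4); and if x > K_inf(ν, μ) − γ/2 then P[ K_inf(ν̂_n, μ) ≤ x ] ≤ exp( −n (K_inf(ν, μ) − x)² / (2γ) ). -/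
open MeasureTheory ProbabilityTheory Real ENNReal
open scoped Classical

/-- `γ = (1/√(1−μ)) (16 e⁻² + ln²(1/(1−μ)))`. -/
noncomputable def gam (μ : ℝ) : ℝ :=
  (1 / Real.sqrt (1 - μ)) * (16 * Real.exp (-2) + Real.log (1 / (1 - μ)) ^ 2)

lemma inv_rn (ρ ν' : Measure ℝ) [IsProbabilityMeasure ρ] [IsProbabilityMeasure ν'] (h : ρ ≪ ν')
    (g : ℝ → ℝ) (hg : Measurable g) (hg0 : ∀ᵐ x ∂ν', 0 ≤ g x) (hgi : Integrable g ν') :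
    Integrable (fun x => g x / (ρ.rnDeriv ν' x).toReal) ρ ∧
      ∫ x, g x / (ρ.rnDeriv ν' x).toReal ∂ρ ≤ ∫ x, g x ∂ν' := by
  have hm : Measurable (fun x => g x / (ρ.rnDeriv ν' x).toReal) :=
    hg.div (Measure.measurable_rnDeriv _ _).ennreal_toReal
  have key : ∫⁻ x, ENNReal.ofReal (g x / (ρ.rnDeriv ν' x).toReal) ∂ρ
      ≤ ∫⁻ x, ENNReal.ofReal (g x) ∂ν' := by
    rw [← lintegral_rnDeriv_mul h hm.ennreal_ofReal.aemeasurable]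
    apply lintegral_mono_ae
    filter_upwards [Measure.rnDeriv_lt_top ρ ν', hg0] with x hx hg
    rcases eq_or_ne (ρ.rnDeriv ν' x) 0 with h0 | h0
    · simp [h0]
    · have hp : 0 < (ρ.rnDeriv ν' x).toReal := ENNReal.toReal_pos h0 hx.ne
      rw [ENNReal.ofReal_div_of_pos hp, ENNReal.ofReal_toReal hx.ne]
      exact ENNReal.mul_div_le
  have h0 : ∀ᵐ x ∂ρ, 0 ≤ g x / (ρ.rnDeriv ν' x).toReal := by
    filter_upwards [h.ae_le hg0] with x hx
    positivity
  have hfin : ∫⁻ x, ENNReal.ofReal (g x) ∂ν' < ⊤ := by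
    rw [← ofReal_integral_eq_lintegral_ofReal hgi hg0]; exact ENNReal.ofReal_lt_top
  refine ⟨⟨hm.aestronglyMeasurable, ?_⟩, ?_⟩
  · rw [hasFiniteIntegral_iff_ofReal h0]
    exact key.trans_lt hfin
  · rw [integral_eq_lintegral_of_nonneg_ae h0 hm.aestronglyMeasurable,
      integral_eq_lintegral_of_nonneg_ae hg0 hg.aestronglyMeasurable]
    exact ENNReal.toReal_mono hfin.ne key

lemma rn_pos (ρ ν' : Measure ℝ) [IsProbabilityMeasure ρ] [IsProbabilityMeasure ν'] (h : ρ ≪ ν') :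
    ∀ᵐ x ∂ρ, 0 < (ρ.rnDeriv ν' x).toReal := by
  filter_upwards [Measure.rnDeriv_pos h, h.ae_le (Measure.rnDeriv_lt_top ρ ν')] with x h1 h2
  exact ENNReal.toReal_pos h1.ne' h2.ne

lemma KL_le_s7 (ν ν' : Measure ℝ) [IsProbabilityMeasure ν] [IsProbabilityMeasure ν']
    (f : ℝ → ℝ) (hf : Measurable f) (hf0 : ∀ᵐ x ∂ν, 0 < f x)
    (hle : ν.withDensity (fun x => ENNReal.ofReal (f x)) ≤ ν')
    (hi : Integrable (fun x => Real.log (f x)) ν) :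
    KL ν ν' ≤ ENNReal.ofReal (- ∫ x, Real.log (f x) ∂ν) := by
  have hac : ν ≪ ν' := by
    refine (withDensity_absolutelyContinuous' hf.ennreal_ofReal.aemeasurable ?_).trans
      (Measure.absolutelyContinuous_of_le hle)
    filter_upwards [hf0] with x hx
    simpa using hx
  have hmr := Measure.measurable_rnDeriv ν ν'
  have h1 : (fun x => ν.rnDeriv ν' x * ENNReal.ofReal (f x)) ≤ᵐ[ν'] fun _ => 1 := by
    apply ae_le_of_forall_setLIntegral_le_of_sigmaFinite (hmr.mul hf.ennreal_ofReal)
    intro s hs _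
    have e1 : ∫⁻ x in s, ν.rnDeriv ν' x * ENNReal.ofReal (f x) ∂ν'
        = ∫⁻ x, ν.rnDeriv ν' x * s.indicator (fun x => ENNReal.ofReal (f x)) x ∂ν' := by
      rw [← lintegral_indicator hs]
      congr 1; ext x
      by_cases hx : x ∈ s <;> simp [hx]
    change ∫⁻ x in s, ν.rnDeriv ν' x * ENNReal.ofReal (f x) ∂ν' ≤ _
    rw [e1, lintegral_rnDeriv_mul hac (hf.ennreal_ofReal.indicator hs).aemeasurable,
      lintegral_indicator hs, ← withDensity_apply _ hs]
    simpa using hle s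
  have h2 : ∀ᵐ x ∂ν, Real.log ((ν.rnDeriv ν' x).toReal) ≤ - Real.log (f x) := by
    filter_upwards [hac.ae_le h1, hf0, rn_pos ν ν' hac] with x hx hfx hr
    have : (ν.rnDeriv ν' x).toReal * f x ≤ 1 := by
      have := ENNReal.toReal_mono ENNReal.one_ne_top hx
      simpa [ENNReal.toReal_mul, ENNReal.toReal_ofReal hfx.le] using this
    have h3 := Real.log_nonpos (by positivity) this
    rw [Real.log_mul hr.ne' hfx.ne'] at h3
    linarith
  obtain ⟨hi1, -⟩ := inv_rn ν ν' hac (fun _ => 1) measurable_const (by simp) (by simp)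
  have hint : Integrable (fun x => Real.log ((ν.rnDeriv ν' x).toReal)) ν := by
    refine Integrable.mono' (g := fun x => |Real.log (f x)| + 1 / (ν.rnDeriv ν' x).toReal)
      (hi.abs.add hi1) hmr.ennreal_toReal.log.aestronglyMeasurable ?_
    filter_upwards [h2, rn_pos ν ν' hac] with x hx hr
    have h3 := Real.one_sub_inv_le_log_of_pos hr
    have h4 : 0 < 1 / (ν.rnDeriv ν' x).toReal := by positivity
    rw [← one_div] at h3
    rw [Real.norm_eq_abs, abs_le]
    have := neg_abs_le (Real.log (f x))
    have := abs_nonneg (Real.log (f x))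
    constructor <;> linarith
  rw [KL, if_pos ⟨hac, hint⟩]
  apply ENNReal.ofReal_le_ofReal
  rw [← integral_neg]
  exact integral_mono_ae hint hi.neg h2

lemma KL_ge (ρ ν' : Measure ℝ) [IsProbabilityMeasure ρ] [IsProbabilityMeasure ν']
    (Y : ℝ → ℝ) (hY : Measurable Y) (hY0 : ∀ᵐ x ∂ν', 0 ≤ Y x) (hYp : ∀ᵐ x ∂ρ, 0 < Y x)
    (hYi : Integrable Y ν') (hY1 : ∫ x, Y x ∂ν' ≤ 1)
    (hi : Integrable (fun x => Real.log (Y x)) ρ) :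
    ENNReal.ofReal (∫ x, Real.log (Y x) ∂ρ) ≤ KL ρ ν' := by
  rw [KL]
  split_ifs with h
  · obtain ⟨hac, hint⟩ := h
    apply ENNReal.ofReal_le_ofReal
    obtain ⟨h1, h2⟩ := inv_rn ρ ν' hac Y hY hY0 hYi
    have h3 : ∫ x, (Real.log (Y x) + 1 - Y x / (ρ.rnDeriv ν' x).toReal) ∂ρ
        ≤ ∫ x, Real.log ((ρ.rnDeriv ν' x).toReal) ∂ρ := by
      refine integral_mono_ae ((hi.add (integrable_const 1)).sub h1) hint ?_
      filter_upwards [hYp, rn_pos ρ ν' hac] with x hx hr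
      have := Real.log_le_sub_one_of_pos (div_pos hx hr)
      rw [Real.log_div hx.ne' hr.ne'] at this
      linarith
    have h4 : Integrable (fun x => Real.log (Y x) + 1) ρ := hi.add (integrable_const 1)
    rw [integral_sub h4 h1, integral_add hi (integrable_const 1)] at h3
    simp at h3
    linarith
  · exact le_top

lemma integrable_of_supp (ν : Measure ℝ) [IsFiniteMeasure ν] (h : ν (Set.Icc (0:ℝ) 1)ᶜ = 0) :
    Integrable (fun y : ℝ => y) ν := by
  refine Integrable.mono' (integrable_const (1:ℝ)) measurable_id.aestronglyMeasurable ?_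
  have : ∀ᵐ x ∂ν, x ∈ Set.Icc (0:ℝ) 1 := h
  filter_upwards [this] with x hx
  rw [Real.norm_eq_abs, abs_of_nonneg hx.1]; exact hx.2

lemma Kinf_le (ν : Measure ℝ) [IsProbabilityMeasure ν] (hsupp : ν (Set.Icc (0:ℝ) 1)ᶜ = 0)
    (μ : ℝ) (f : ℝ → ℝ) (hf : Measurable f) (hf0 : ∀ᵐ x ∂ν, 0 < f x)
    (hfi : Integrable f ν) (hf1 : ∫ x, f x ∂ν ≤ 1) (hm : ∫ x, f x * (1 - x) ∂ν < 1 - μ)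
    (hi : Integrable (fun x => Real.log (f x)) ν) :
    Kinf ν μ ≤ ENNReal.ofReal (- ∫ x, Real.log (f x) ∂ν) := by
  set c : ℝ := 1 - ∫ x, f x ∂ν with hc
  have hc0 : 0 ≤ c := by rw [hc]; linarith
  set w : Measure ℝ := ν.withDensity (fun x => ENNReal.ofReal (f x)) with hw
  set ν' : Measure ℝ := w + ENNReal.ofReal c • Measure.dirac 1 with hν'
  have hf0' : 0 ≤ᵐ[ν] f := hf0.mono (fun x hx => hx.le)
  have hwu : w Set.univ = ENNReal.ofReal (∫ x, f x ∂ν) := by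
    rw [hw, withDensity_apply _ MeasurableSet.univ, Measure.restrict_univ,
      ofReal_integral_eq_lintegral_ofReal hfi hf0']
  have hp : IsProbabilityMeasure ν' := by
    constructor
    rw [hν', Measure.add_apply, hwu, Measure.smul_apply]
    simp only [measure_univ, smul_eq_mul, mul_one]
    rw [← ENNReal.ofReal_add (integral_nonneg_of_ae hf0') hc0, hc]
    simp
  have hwf : IsFiniteMeasure w := ⟨by rw [hwu]; exact ENNReal.ofReal_lt_top⟩
  have hws : w (Set.Icc (0:ℝ) 1)ᶜ = 0 := withDensity_absolutelyContinuous _ _ hsupp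
  have hs : ν' (Set.Icc (0:ℝ) 1)ᶜ = 0 := by
    rw [hν', Measure.add_apply, hws, Measure.smul_apply]
    simp
  have hmean : μ < ∫ y, y ∂ν' := by
    have hiw : Integrable (fun y : ℝ => 1 - y) w :=
      (integrable_const (1:ℝ)).sub (integrable_of_supp w hws)
    have hid : Integrable (fun y : ℝ => 1 - y) (ENNReal.ofReal c • Measure.dirac (1:ℝ)) := by
      apply Integrable.smul_measure _ ENNReal.ofReal_ne_top
      exact integrable_dirac (by simp)
    have e1 : ∫ y, (1 - y) ∂ν' = ∫ y, f y * (1 - y) ∂ν := by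
      rw [hν', integral_add_measure hiw hid, integral_smul_measure, integral_dirac, hw,
        integral_withDensity_eq_integral_toReal_smul₀ hf.ennreal_ofReal.aemeasurable (by simp)]
      simp only [sub_self, smul_zero, add_zero]
      apply integral_congr_ae
      filter_upwards [hf0'] with x hx
      rw [ENNReal.toReal_ofReal hx, smul_eq_mul]
    rw [integral_sub (integrable_const _) (integrable_of_supp ν' hs)] at e1
    simp at e1
    linarith
  have hKL := KL_le_s7 ν ν' f hf hf0 (by rw [hν']; exact Measure.le_add_right le_rfl) hi
  refine le_trans ?_ hKL
  exact iInf_le_of_le ν' (iInf_le_of_le hp (iInf_le_of_le hs (iInf_le_of_le hmean le_rfl)))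

lemma Kinf_ne_top (ν : Measure ℝ) [IsProbabilityMeasure ν] (hsupp : ν (Set.Icc (0:ℝ) 1)ᶜ = 0)
    (μ : ℝ) (h0 : 0 ≤ μ) (h1 : μ < 1) : Kinf ν μ ≠ ⊤ := by
  have h := Kinf_le ν hsupp μ (fun _ => (1 - μ) / 2) measurable_const
    (Filter.Eventually.of_forall fun _ => by linarith) (integrable_const _)
    (by simp; linarith) ?_ (integrable_const _)
  · exact ne_top_of_le_ne_top ENNReal.ofReal_ne_top h
  · rw [integral_const_mul, integral_sub (integrable_const _) (integrable_of_supp ν hsupp)]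
    have : 0 ≤ ∫ y, y ∂ν := by
      apply integral_nonneg_of_ae
      have : ∀ᵐ x ∂ν, x ∈ Set.Icc (0:ℝ) 1 := hsupp
      filter_upwards [this] with x hx using hx.1
    simp
    nlinarith

/-- dual function -/
noncomputable def YY (μ l x : ℝ) : ℝ := (1 - l) + l * ((1 - x) / (1 - μ))

lemma YY_meas (μ l : ℝ) : Measurable (YY μ l) := by unfold YY; fun_prop

lemma YY_ge {μ l x : ℝ} (h1 : μ < 1) (hl : 0 ≤ l) (hx : x ∈ Set.Icc (0:ℝ) 1) :
    1 - l ≤ YY μ l x := by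
  have h : 0 ≤ (1 - x) / (1 - μ) := div_nonneg (by linarith [hx.2]) (by linarith)
  unfold YY
  nlinarith

lemma YY_le {μ l x : ℝ} (h0 : 0 ≤ μ) (h1 : μ < 1) (hl : 0 ≤ l) (hl1 : l ≤ 1)
    (hx : x ∈ Set.Icc (0:ℝ) 1) : YY μ l x ≤ 1 / (1 - μ) := by
  have h : (1 - x) / (1 - μ) ≤ 1 / (1 - μ) := by
    apply div_le_div_of_nonneg_right _ (by linarith); linarith [hx.1]
  have h2 : 1 ≤ 1 / (1 - μ) := by rw [le_div_iff₀ (by linarith)]; linarith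
  unfold YY
  nlinarith

lemma Kinf_ge (ρ : Measure ℝ) [IsProbabilityMeasure ρ]
    (μ l : ℝ) (h1 : μ < 1) (hl : 0 ≤ l) (hl1 : l ≤ 1) (hYp : ∀ᵐ x ∂ρ, 0 < YY μ l x)
    (hi : Integrable (fun x => Real.log (YY μ l x)) ρ) :
    ENNReal.ofReal (∫ x, Real.log (YY μ l x) ∂ρ) ≤ Kinf ρ μ := by
  refine le_iInf fun ν' => le_iInf fun hp => le_iInf fun hs => le_iInf fun hm => ?_
  have hs' : ∀ᵐ x ∂ν', x ∈ Set.Icc (0:ℝ) 1 := hs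
  have hid := integrable_of_supp ν' hs
  have hid2 : Integrable (fun x : ℝ => l * ((1 - x) / (1 - μ))) ν' :=
    (((integrable_const _).sub hid).div_const _).const_mul _
  refine KL_ge ρ ν' (YY μ l) (YY_meas _ _) ?_ hYp ?_ ?_ hi
  · filter_upwards [hs'] with x hx
    linarith [YY_ge h1 hl hx]
  · exact (integrable_const _).add hid2
  · unfold YY
    rw [integral_add (integrable_const _) hid2, integral_const_mul, integral_div,
      integral_sub (integrable_const _) hid]
    simp only [integral_const, probReal_univ, smul_eq_mul, one_mul]
    have : (1 - ∫ y, y ∂ν') / (1 - μ) ≤ 1 := by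
      rw [div_le_one (by linarith)]; linarith
    nlinarith

lemma YY_inv {μ l x : ℝ} (h1 : μ < 1) (h : YY μ l x ≠ 0) :
    (YY μ l x)⁻¹ = 1 + l / (1 - μ) * ((x - μ) / YY μ l x) := by
  have h2 : 1 - μ ≠ 0 := by linarith
  have e : YY μ l x = 1 - l / (1 - μ) * (x - μ) := by unfold YY; field_simp; ring
  have e3 : l / (1 - μ) * (x - μ) = 1 - YY μ l x := by rw [e]; ring
  rw [mul_div_assoc', e3]
  field_simp
  ring

lemma exists_dual (ν : Measure ℝ) [IsProbabilityMeasure ν] (hsupp : ν (Set.Icc (0:ℝ) 1)ᶜ = 0)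
    (μ : ℝ) (h0 : ∫ y, y ∂ν < μ) (hμ0 : 0 ≤ μ) (h1 : μ < 1) :
    ∃ l : ℝ, 0 ≤ l ∧ l ≤ 1 ∧ (∀ᵐ x ∂ν, 0 < YY μ l x) ∧ Integrable (fun x => (YY μ l x)⁻¹) ν ∧
      ∫ x, (YY μ l x)⁻¹ ∂ν ≤ 1 ∧ ∫ x, (YY μ l x)⁻¹ * (1 - x) ∂ν ≤ 1 - μ := by
  have hs : ∀ᵐ x ∂ν, x ∈ Set.Icc (0:ℝ) 1 := hsupp
  have hpos : ∀ l : ℝ, 0 ≤ l → l < 1 → ∀ᵐ x ∂ν, 0 < YY μ l x := by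
    intro l hl hl1
    filter_upwards [hs] with x hx
    linarith [YY_ge h1 hl hx]
  have hkb : ∀ b l : ℝ, b < 1 → 0 ≤ l → l ≤ b → ∀ᵐ x ∂ν, ‖(x - μ) / YY μ l x‖ ≤ 1 / (1 - b) := by
    intro b l hb hl hlb
    filter_upwards [hs] with x hx
    have := YY_ge h1 hl hx
    rw [norm_div, Real.norm_eq_abs, Real.norm_eq_abs, abs_of_pos (a := YY μ l x) (by linarith)]
    apply div_le_div₀ (by norm_num) _ (by linarith) (by linarith)
    rw [abs_le]; constructor <;> linarith [hx.1, hx.2]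
  have hkm : ∀ l : ℝ, Measurable fun x => (x - μ) / YY μ l x := fun l =>
    (measurable_id.sub_const _).div (YY_meas _ _)
  have hki : ∀ l : ℝ, 0 ≤ l → l < 1 → Integrable (fun x => (x - μ) / YY μ l x) ν := by
    intro l hl hl1
    exact Integrable.mono' (integrable_const _) (hkm l).aestronglyMeasurable (hkb l l hl1 hl le_rfl)
  have hinvae : ∀ l : ℝ, 0 ≤ l → l < 1 →
      (fun x => (YY μ l x)⁻¹) =ᵐ[ν] fun x => 1 + l / (1 - μ) * ((x - μ) / YY μ l x) := by
    intro l hl hl1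
    filter_upwards [hpos l hl hl1] with x hx
    exact YY_inv h1 hx.ne'
  have hinvi : ∀ l : ℝ, 0 ≤ l → l < 1 → Integrable (fun x => (YY μ l x)⁻¹) ν := by
    intro l hl hl1
    rw [integrable_congr (hinvae l hl hl1)]
    exact (integrable_const _).add ((hki l hl hl1).const_mul _)
  have hinv : ∀ l : ℝ, 0 ≤ l → l < 1 → ∫ x, (YY μ l x)⁻¹ ∂ν
      = 1 + l / (1 - μ) * ∫ x, (x - μ) / YY μ l x ∂ν := by
    intro l hl hl1
    rw [integral_congr_ae (hinvae l hl hl1), integral_add (integrable_const _)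
      ((hki l hl hl1).const_mul _), integral_const_mul]
    simp
  have hk0 : ∫ x, (x - μ) / YY μ 0 x ∂ν < 0 := by
    simp only [YY, sub_zero, zero_mul, add_zero, div_one]
    rw [integral_sub (integrable_of_supp ν hsupp) (integrable_const _)]
    simp; linarith
  by_cases hex : ∃ b : ℝ, 0 ≤ b ∧ b < 1 ∧ 0 ≤ ∫ x, (x - μ) / YY μ b x ∂ν
  · obtain ⟨b, hb0, hb1, hb⟩ := hex
    have hcont : ContinuousOn (fun l => ∫ x, (x - μ) / YY μ l x ∂ν) (Set.Icc 0 b) := by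
      refine continuousOn_of_dominated (bound := fun _ => 1 / (1 - b))
        (fun l _ => (hkm l).aestronglyMeasurable) (fun l hl => hkb b l hb1 hl.1 hl.2)
        (integrable_const _) ?_
      filter_upwards [hs] with x hx
      apply ContinuousOn.div continuousOn_const
      · unfold YY; fun_prop
      · intro l hl
        have := YY_ge h1 hl.1 hx
        have := hl.2
        linarith
    obtain ⟨l, hl, hlz⟩ := intermediate_value_Icc hb0 hcont ⟨hk0.le, hb⟩
    have hl1 : l < 1 := hl.2.trans_lt hb1
    simp only at hlz
    have hi1 : ∫ x, (YY μ l x)⁻¹ ∂ν = 1 := by rw [hinv l hl.1 hl1, hlz]; simp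
    refine ⟨l, hl.1, hl1.le, hpos l hl.1 hl1, hinvi l hl.1 hl1, hi1.le, ?_⟩
    have e : ∀ x, (YY μ l x)⁻¹ * (1 - x) = (1 - μ) * (YY μ l x)⁻¹ - (x - μ) / YY μ l x := by
      intro x; rw [div_eq_mul_inv]; ring
    simp_rw [e]
    rw [integral_sub ((hinvi l hl.1 hl1).const_mul _) (hki l hl.1 hl1), integral_const_mul, hi1, hlz]
    simp
  · push Not at hex
    have hle : ∀ l : ℝ, 0 ≤ l → l < 1 → ∫ x, (YY μ l x)⁻¹ ∂ν ≤ 1 := by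
      intro l hl hl1
      rw [hinv l hl hl1]
      have := hex l hl hl1
      have h3 : 0 ≤ l / (1 - μ) := div_nonneg hl (by linarith)
      nlinarith
    have hlint : ∀ l : ℝ, 0 ≤ l → l < 1 → ∫⁻ x, ENNReal.ofReal (YY μ l x)⁻¹ ∂ν ≤ 1 := by
      intro l hl hl1
      rw [← ofReal_integral_eq_lintegral_ofReal (hinvi l hl hl1)
        ((hpos l hl hl1).mono fun x hx => (inv_pos.2 hx).le)]
      exact ENNReal.ofReal_le_one.2 (hle l hl hl1)
    -- no mass at one
    have hone : ν {1} = 0 := by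
      have hb : ∀ l : ℝ, 0 ≤ l → l < 1 → ν {1} ≤ ENNReal.ofReal (1 - l) := by
        intro l hl hl1
        have h2 : ∫⁻ x in {1}, ENNReal.ofReal (YY μ l x)⁻¹ ∂ν ≤ 1 :=
          (setLIntegral_le_lintegral _ _).trans (hlint l hl hl1)
        rw [lintegral_singleton] at h2
        have h3 : YY μ l 1 = 1 - l := by simp [YY]
        rw [h3, ENNReal.ofReal_inv_of_pos (by linarith), mul_comm, ← div_eq_mul_inv] at h2
        rw [ENNReal.div_le_iff (by simpa using hl1) ENNReal.ofReal_ne_top] at h2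
        simpa using h2
      by_contra hne
      have hr : 0 < (ν {1}).toReal := ENNReal.toReal_pos hne (measure_ne_top _ _)
      have hr1 : (ν {1}).toReal ≤ 1 := by
        have := ENNReal.toReal_mono ENNReal.one_ne_top (prob_le_one (μ := ν) (s := {1})); simpa using this
      have := ENNReal.toReal_mono ENNReal.ofReal_ne_top
        (hb (1 - (ν {1}).toReal / 2) (by linarith) (by linarith))
      rw [ENNReal.toReal_ofReal (by linarith)] at this
      linarith
    have hs1 : ∀ᵐ x ∂ν, x ∈ Set.Icc (0:ℝ) 1 ∧ x < 1 := by
      have h2 : ∀ᵐ x ∂ν, x ∉ ({1} : Set ℝ) := measure_eq_zero_iff_ae_notMem.1 hone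
      filter_upwards [hs, h2] with x hx hx2
      exact ⟨hx, lt_of_le_of_ne hx.2 (by simpa using hx2)⟩
    have hp1 : ∀ᵐ x ∂ν, 0 < YY μ 1 x := by
      filter_upwards [hs1] with x hx
      have : 0 < (1 - x) / (1 - μ) := div_pos (by linarith [hx.2]) (by linarith)
      simpa [YY] using this
    have hlint1 : ∫⁻ x, ENNReal.ofReal (YY μ 1 x)⁻¹ ∂ν ≤ 1 := by
      let a : ℕ → ℝ := fun m => 1 - 1 / ((m : ℝ) + 1)
      have ha : Filter.Tendsto a Filter.atTop (nhds 1) := by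
        have := (tendsto_one_div_add_atTop_nhds_zero_nat (𝕜 := ℝ)).const_sub 1
        simpa [a] using this
      have ha0 : ∀ m, 0 ≤ a m := by
        intro m
        have : 1 / ((m : ℝ) + 1) ≤ 1 := by
          rw [div_le_one (by positivity)]; linarith [Nat.cast_nonneg (α := ℝ) m]
        simp only [a]; linarith
      have ha1 : ∀ m, a m < 1 := by
        intro m
        have : 0 < 1 / ((m : ℝ) + 1) := by positivity
        simp only [a]; linarith
      calc ∫⁻ x, ENNReal.ofReal (YY μ 1 x)⁻¹ ∂ν
          = ∫⁻ x, Filter.liminf (fun m => ENNReal.ofReal (YY μ (a m) x)⁻¹) Filter.atTop ∂ν := by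
            apply lintegral_congr_ae
            filter_upwards [hp1] with x hx
            symm
            apply Filter.Tendsto.liminf_eq
            apply ENNReal.tendsto_ofReal
            apply Filter.Tendsto.inv₀ _ hx.ne'
            have hc : Continuous fun l => YY μ l x := by unfold YY; fun_prop
            exact (hc.tendsto 1).comp ha
        _ ≤ Filter.liminf (fun m => ∫⁻ x, ENNReal.ofReal (YY μ (a m) x)⁻¹ ∂ν) Filter.atTop :=
            lintegral_liminf_le fun m => (YY_meas _ _).inv.ennreal_ofReal
        _ ≤ Filter.liminf (fun _ : ℕ => (1 : ℝ≥0∞)) Filter.atTop :=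
            Filter.liminf_le_liminf (Filter.Eventually.of_forall fun m => hlint _ (ha0 m) (ha1 m))
        _ = 1 := by simp
    have hn1 : 0 ≤ᵐ[ν] fun x => (YY μ 1 x)⁻¹ := hp1.mono fun x hx => (inv_pos.2 hx).le
    have hm1 : Measurable fun x => (YY μ 1 x)⁻¹ := (YY_meas _ _).inv
    refine ⟨1, zero_le_one, le_rfl, hp1, ⟨hm1.aestronglyMeasurable, ?_⟩, ?_, ?_⟩
    · rw [hasFiniteIntegral_iff_ofReal hn1]
      exact hlint1.trans_lt ENNReal.one_lt_top
    · rw [integral_eq_lintegral_of_nonneg_ae hn1 hm1.aestronglyMeasurable]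
      have := ENNReal.toReal_mono ENNReal.one_ne_top hlint1
      simpa using this
    · have e : (fun x => (YY μ 1 x)⁻¹ * (1 - x)) =ᵐ[ν] fun _ => 1 - μ := by
        filter_upwards [hs1] with x hx
        have : 1 - x ≠ 0 := by linarith [hx.2]
        have : 1 - μ ≠ 0 := by linarith
        have h3 : YY μ 1 x = (1 - x) / (1 - μ) := by simp [YY]
        rw [h3]
        field_simp
      rw [integral_congr_ae e]; simp

/-- Upper bound on `Kinf` through the dual point. -/
lemma Kinf_toReal_le (ν : Measure ℝ) [IsProbabilityMeasure ν] (hsupp : ν (Set.Icc (0:ℝ) 1)ᶜ = 0)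
    (μ l : ℝ) (h1 : μ < 1) (hYp : ∀ᵐ x ∂ν, 0 < YY μ l x)
    (hI : Integrable (fun x => (YY μ l x)⁻¹) ν)
    (hI1 : ∫ x, (YY μ l x)⁻¹ ∂ν ≤ 1) (hm : ∫ x, (YY μ l x)⁻¹ * (1 - x) ∂ν ≤ 1 - μ)
    (hi : Integrable (fun x => Real.log (YY μ l x)) ν) :
    (Kinf ν μ).toReal ≤ ∫ x, Real.log (YY μ l x) ∂ν := by
  have hnn : 0 ≤ ∫ x, Real.log (YY μ l x) ∂ν := by
    have h2 : ∫ x, (1 - (YY μ l x)⁻¹) ∂ν ≤ ∫ x, Real.log (YY μ l x) ∂ν := by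
      refine integral_mono_ae ((integrable_const _).sub hI) hi ?_
      filter_upwards [hYp] with x hx using Real.one_sub_inv_le_log_of_pos hx
    rw [integral_sub (integrable_const _) hI] at h2
    simp at h2
    linarith
  have key : ∀ s ∈ Set.Ioo (0:ℝ) 1, (Kinf ν μ).toReal ≤ ∫ x, Real.log (YY μ l x) ∂ν - Real.log s := by
    intro s hs
    have elog : (fun x => Real.log (s * (YY μ l x)⁻¹)) =ᵐ[ν]
        fun x => Real.log s - Real.log (YY μ l x) := by
      filter_upwards [hYp] with x hx
      rw [Real.log_mul hs.1.ne' (inv_pos.2 hx).ne', Real.log_inv]; ring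
    have h := Kinf_le ν hsupp μ (fun x => s * (YY μ l x)⁻¹) ((YY_meas _ _).inv.const_mul _)
      (by filter_upwards [hYp] with x hx using mul_pos hs.1 (inv_pos.2 hx))
      (hI.const_mul _) (by
        have : 0 ≤ ∫ x, (YY μ l x)⁻¹ ∂ν :=
          integral_nonneg_of_ae (hYp.mono fun x hx => (inv_pos.2 hx).le)
        rw [integral_const_mul]; nlinarith [hs.1, hs.2])
      (by
        simp_rw [mul_assoc]
        rw [integral_const_mul]; nlinarith [hs.1, hs.2])
      (by rw [integrable_congr elog]; exact (integrable_const _).sub hi)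
    rw [integral_congr_ae elog, integral_sub (integrable_const _) hi] at h
    simp only [integral_const, probReal_univ, smul_eq_mul, one_mul, neg_sub] at h
    have hls := Real.log_neg hs.1 hs.2
    have := ENNReal.toReal_mono ENNReal.ofReal_ne_top h
    rwa [ENNReal.toReal_ofReal (by linarith)] at this
  refine le_of_forall_pos_le_add fun ε hε => ?_
  have := key (Real.exp (-ε)) ⟨Real.exp_pos _, by rw [Real.exp_lt_one_iff]; linarith⟩
  rw [Real.log_exp] at this
  linarith

lemma exp_aux1 {s : ℝ} (hs : 0 ≤ s) : Real.exp (-s) ≤ 1 - s + s ^ 2 / 2 := by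
  have h := Real.quadratic_le_exp_of_nonneg hs
  have hp : 0 < 1 - s + s ^ 2 / 2 := by nlinarith [sq_nonneg (s - 1)]
  rw [Real.exp_neg, inv_le_comm₀ (Real.exp_pos _) hp]
  refine le_trans ?_ h
  rw [inv_le_iff_one_le_mul₀ hp]
  nlinarith [sq_nonneg (s ^ 2)]

lemma exp_aux2 {s : ℝ} (hs : 0 ≤ s) : Real.exp s ≤ 1 + s + s ^ 2 / 2 * Real.exp s := by
  have hm : MonotoneOn (fun s : ℝ => (1 + s) * Real.exp (-s) + s ^ 2 / 2) (Set.Ici 0) := by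
    have hd : ∀ s : ℝ, HasDerivAt (fun s : ℝ => (1 + s) * Real.exp (-s) + s ^ 2 / 2)
        (s * (1 - Real.exp (-s))) s := by
      intro s
      have h1 : HasDerivAt (fun s : ℝ => 1 + s) 1 s := (hasDerivAt_id s).const_add 1
      have h2 : HasDerivAt (fun s : ℝ => Real.exp (-s)) (Real.exp (-s) * (-1)) s :=
        ((hasDerivAt_id s).neg).exp
      have h3 : HasDerivAt (fun s : ℝ => s ^ 2 / 2) (2 * s / 2) s := by
        simpa using (hasDerivAt_pow 2 s).div_const 2
      exact ((h1.mul h2).add h3).congr_deriv (by ring)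
    apply monotoneOn_of_deriv_nonneg (convex_Ici 0)
    · exact fun s _ => (hd s).continuousAt.continuousWithinAt
    · exact fun s _ => (hd s).differentiableAt.differentiableWithinAt
    · intro s hs
      rw [interior_Ici] at hs
      rw [(hd s).deriv]
      have : Real.exp (-s) ≤ 1 := Real.exp_le_one_iff.2 (by linarith [Set.mem_Ioi.1 hs])
      exact mul_nonneg (le_of_lt hs) (by linarith)
  have h := hm (Set.mem_Ici.2 le_rfl) (Set.mem_Ici.2 hs) hs
  simp only [neg_zero, Real.exp_zero] at h
  have he := Real.exp_pos s
  have h5 : Real.exp (-s) * Real.exp s = 1 := by rw [← Real.exp_add]; simp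
  have h6 := mul_le_mul_of_nonneg_right h he.le
  have h7 : ((1 + s) * Real.exp (-s) + s ^ 2 / 2) * Real.exp s
      = (1 + s) * (Real.exp (-s) * Real.exp s) + s ^ 2 / 2 * Real.exp s := by ring
  rw [h7, h5] at h6
  nlinarith

lemma exp_aux3 {v : ℝ} (hv : 0 ≤ v) : v ^ 2 * Real.exp (v / 2) ≤ 16 * Real.exp (-2) * Real.exp v := by
  have h1 : v / 4 ≤ Real.exp (v / 4 - 1) := by linarith [Real.add_one_le_exp (v / 4 - 1)]
  have h2 : (v / 4) ^ 2 ≤ Real.exp (v / 2 - 2) := by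
    have : Real.exp (v / 2 - 2) = Real.exp (v / 4 - 1) ^ 2 := by
      rw [← Real.exp_nat_mul]; congr 1; push_cast; ring
    rw [this]
    exact pow_le_pow_left₀ (by positivity) h1 2
  have h3 : Real.exp (-2) * Real.exp v = Real.exp (v / 2 - 2) * Real.exp (v / 2) := by
    rw [← Real.exp_add, ← Real.exp_add]; congr 1; ring
  rw [mul_assoc, h3]
  have := Real.exp_pos (v / 2)
  nlinarith

lemma exp_aux {t U L : ℝ} (ht : 0 ≤ t) (ht2 : t ≤ 1 / 2) (hU : U ≤ L) (hL : 0 ≤ L) :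
    Real.exp (-t * U) ≤ 1 - t * U + t ^ 2 / 2 * (L ^ 2 + 16 * Real.exp (-2) * Real.exp (-U)) := by
  rcases le_total 0 U with h | h
  · have h1 := exp_aux1 (mul_nonneg ht h)
    have h2 : U ^ 2 ≤ L ^ 2 := pow_le_pow_left₀ h hU 2
    have h3 : 0 ≤ 16 * Real.exp (-2) * Real.exp (-U) := by positivity
    have h4 : t ^ 2 / 2 * U ^ 2 ≤ t ^ 2 / 2 * (L ^ 2 + 16 * Real.exp (-2) * Real.exp (-U)) :=
      mul_le_mul_of_nonneg_left (by linarith) (by positivity)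
    rw [neg_mul]
    nlinarith
  · obtain ⟨v, rfl⟩ : ∃ v, U = -v := ⟨-U, by ring⟩
    have hv : 0 ≤ v := by linarith
    have h1 := exp_aux2 (mul_nonneg ht hv)
    have h2 := exp_aux3 hv
    have h3 : Real.exp (t * v) ≤ Real.exp (v / 2) := Real.exp_le_exp.2 (by nlinarith)
    have h4 : v ^ 2 * Real.exp (t * v) ≤ L ^ 2 + 16 * Real.exp (-2) * Real.exp v := by
      have := mul_le_mul_of_nonneg_left h3 (sq_nonneg v)
      nlinarith [sq_nonneg L]
    have h5 := mul_le_mul_of_nonneg_left h4 (show 0 ≤ t ^ 2 / 2 by positivity)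
    rw [neg_mul_neg, neg_neg]
    nlinarith

lemma gam_ge {μ : ℝ} (h0 : 0 ≤ μ) (h1 : μ < 1) :
    16 * Real.exp (-2) + Real.log (1 / (1 - μ)) ^ 2 ≤ gam μ := by
  unfold gam
  have h2 : 1 ≤ 1 / Real.sqrt (1 - μ) := by
    have : 0 < Real.sqrt (1 - μ) := Real.sqrt_pos.2 (by linarith)
    rw [le_div_iff₀ this, one_mul]
    exact Real.sqrt_le_one.2 (by linarith)
  have h3 : 0 ≤ 16 * Real.exp (-2) + Real.log (1 / (1 - μ)) ^ 2 := by positivity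
  nlinarith

lemma two_le_gam {μ : ℝ} (h0 : 0 ≤ μ) (h1 : μ < 1) : 2 ≤ gam μ := by
  refine le_trans ?_ (gam_ge h0 h1)
  have h2 : Real.exp 2 ≤ 8 := by
    have := Real.exp_one_lt_d9
    have h3 : Real.exp 2 = Real.exp 1 ^ 2 := by rw [← Real.exp_nat_mul]; norm_num
    rw [h3]; nlinarith [Real.exp_pos 1]
  have h4 : 1 / 8 ≤ Real.exp (-2) := by
    rw [Real.exp_neg, ← one_div]
    exact one_div_le_one_div_of_le (Real.exp_pos _) h2
  nlinarith [sq_nonneg (Real.log (1 / (1 - μ)))]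

lemma emp_ae {Ω : Type*} {n : ℕ} (X : Fin n → Ω → ℝ) (ω : Ω) (S : Set ℝ)
    (hS : MeasurableSet S) (h : ∀ i, X i ω ∈ S) : emp X ω Sᶜ = 0 := by
  simp [emp, Measure.dirac_apply' _ hS.compl, h]

lemma emp_prob {Ω : Type*} {n : ℕ} (hn : 1 ≤ n) (X : Fin n → Ω → ℝ) (ω : Ω) :
    IsProbabilityMeasure (emp X ω) := by
  constructor
  simp only [emp, Measure.smul_apply, Measure.finsetSum_apply, measure_univ, smul_eq_mul]
  simp
  exact ENNReal.inv_mul_cancel (by simp; omega) (by simp)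

lemma emp_integrable {Ω : Type*} {n : ℕ} (hn : 1 ≤ n) (X : Fin n → Ω → ℝ) (ω : Ω) (g : ℝ → ℝ) :
    Integrable g (emp X ω) := by
  apply Integrable.smul_measure _ (by simp; omega)
  rw [integrable_finsetSum_measure]
  intro i _
  exact integrable_dirac (by simp)

lemma emp_integral {Ω : Type*} {n : ℕ} (X : Fin n → Ω → ℝ) (ω : Ω) (g : ℝ → ℝ) :
    ∫ x, g x ∂(emp X ω) = (n : ℝ)⁻¹ * ∑ i, g (X i ω) := by
  rw [emp, integral_smul_measure, integral_finsetSum_measure]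
  · simp
  · intro i _
    exact integrable_dirac (by simp)

lemma main_bound {Ω : Type*} [MeasurableSpace Ω]
    (P : Measure Ω) [IsProbabilityMeasure P]
    (ν : Measure ℝ) [IsProbabilityMeasure ν] (hsupp : ν (Set.Icc (0:ℝ) 1)ᶜ = 0)
    (n : ℕ) (hn : 1 ≤ n) (X : Fin n → Ω → ℝ) (hmeas : ∀ i, Measurable (X i))
    (hindep : iIndepFun X P)
    (hdist : ∀ i, Measure.map (X i) P = ν)
    (μ : ℝ) (hE : ∫ y, y ∂ν < μ) (h0 : 0 ≤ μ) (h1 : μ < 1) (x t : ℝ) (ht : 0 ≤ t)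
    (ht2 : t ≤ 1 / 2) :
    P {ω | (Kinf (emp X ω) μ).toReal ≤ x}
      ≤ ENNReal.ofReal (Real.exp (n * (t * x - t * (Kinf ν μ).toReal + t ^ 2 / 2 * gam μ))) := by
  obtain ⟨l, hl, hl1, hYp, hI, hI1, hm⟩ := exists_dual ν hsupp μ hE h0 h1
  have hs : ∀ᵐ x ∂ν, x ∈ Set.Icc (0:ℝ) 1 := hsupp
  set L := Real.log (1 / (1 - μ)) with hL
  have hL0 : 0 ≤ L := Real.log_nonneg (by rw [le_div_iff₀ (by linarith)]; linarith)
  set U : ℝ → ℝ := fun y => Real.log (YY μ l y) with hU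
  have hUm : Measurable U := (YY_meas _ _).log
  have hUL : ∀ᵐ y ∂ν, U y ≤ L := by
    filter_upwards [hs, hYp] with y hy hy2
    exact Real.log_le_log hy2 (YY_le h0 h1 hl hl1 hy)
  have hi : Integrable U ν := by
    refine Integrable.mono' ((integrable_const L).add hI) hUm.aestronglyMeasurable ?_
    filter_upwards [hUL, hYp] with y h2 h3
    have h4 := Real.one_sub_inv_le_log_of_pos h3
    have h5 := inv_pos.2 h3
    simp only [Pi.add_apply]
    rw [Real.norm_eq_abs, abs_le]
    constructor
    · simp only [hU]; linarith
    · linarith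
  have hM := Kinf_toReal_le ν hsupp μ l h1 hYp hI hI1 hm hi
  change _ ≤ ∫ y, U y ∂ν at hM
  set M := ∫ y, U y ∂ν with hMdef
  set K := (Kinf ν μ).toReal with hK
  have hpt : ∀ᵐ y ∂ν, Real.exp (-t * U y) ≤
      1 - t * U y + t ^ 2 / 2 * (L ^ 2 + 16 * Real.exp (-2) * (YY μ l y)⁻¹) := by
    filter_upwards [hUL, hYp] with y h2 h3
    have := exp_aux ht ht2 h2 hL0
    have e : Real.exp (-U y) = (YY μ l y)⁻¹ := by
      rw [Real.exp_neg]; simp only [hU]; rw [Real.exp_log h3]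
    rwa [e] at this
  have hi2 : Integrable (fun y => 1 - t * U y) ν := (integrable_const _).sub (hi.const_mul _)
  have hi4 : Integrable (fun y => 16 * Real.exp (-2) * (YY μ l y)⁻¹) ν := hI.const_mul _
  have hi5 : Integrable (fun y => L ^ 2 + 16 * Real.exp (-2) * (YY μ l y)⁻¹) ν :=
    (integrable_const _).add hi4
  have hi3 : Integrable (fun y => t ^ 2 / 2 * (L ^ 2 + 16 * Real.exp (-2) * (YY μ l y)⁻¹)) ν :=
    hi5.const_mul _
  have hexpm : Measurable fun y => Real.exp (-t * U y) := (hUm.const_mul _).exp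
  have hexpi : Integrable (fun y => Real.exp (-t * U y)) ν := by
    refine Integrable.mono' (hi2.add hi3) hexpm.aestronglyMeasurable ?_
    filter_upwards [hpt] with y hy
    rw [Real.norm_eq_abs, abs_of_pos (Real.exp_pos _)]
    exact hy
  have hmgf : ∫ y, Real.exp (-t * U y) ∂ν ≤ Real.exp (-t * K + t ^ 2 / 2 * gam μ) := by
    have h2 := integral_mono_ae hexpi (hi2.add hi3) hpt
    simp only [Pi.add_apply] at h2
    rw [integral_add hi2 hi3, integral_sub (integrable_const _) (hi.const_mul _),
      integral_const_mul, integral_const_mul, integral_add (integrable_const _) hi4,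
      integral_const_mul] at h2
    simp only [integral_const, probReal_univ, smul_eq_mul, one_mul] at h2
    refine h2.trans ?_
    have hg := gam_ge h0 h1
    have h5 : L ^ 2 + 16 * Real.exp (-2) * ∫ y, (YY μ l y)⁻¹ ∂ν ≤ gam μ := by
      have := Real.exp_pos (-2)
      nlinarith
    have h6 := mul_le_mul_of_nonneg_left h5 (show 0 ≤ t ^ 2 / 2 by positivity)
    have h7 := mul_le_mul_of_nonneg_left hM ht
    have h8 := Real.add_one_le_exp (-t * K + t ^ 2 / 2 * gam μ)
    linarith
  -- the random variables
  set V : Fin n → Ω → ℝ := fun i => U ∘ X i with hV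
  have hVm : ∀ i, Measurable (V i) := fun i => hUm.comp (hmeas i)
  have hVind : iIndepFun V P := hindep.comp (fun _ => U) (fun _ => hUm)
  have hVi : ∀ i, Integrable (fun ω => Real.exp (-t * V i ω)) P := by
    intro i
    have := hexpi
    rw [← hdist i, integrable_map_measure hexpm.aestronglyMeasurable (hmeas i).aemeasurable] at this
    exact this
  have hVmgf : ∀ i, mgf (V i) P (-t) = ∫ y, Real.exp (-t * U y) ∂ν := by
    intro i
    rw [← hdist i, integral_map (hmeas i).aemeasurable hexpm.aestronglyMeasurable]
    rfl
  have hch := measure_le_le_exp_mul_mgf (X := ∑ i, V i) (μ := P) (t := -t) (n * x) (by linarith)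
    (hVind.integrable_exp_mul_sum hVm (fun i _ => hVi i))
  rw [hVind.mgf_sum hVm, Finset.prod_congr rfl (fun i _ => hVmgf i)] at hch
  simp only [Finset.prod_const, Finset.card_univ, Fintype.card_fin] at hch
  have hfin : P.real {ω | (∑ i, V i) ω ≤ n * x}
      ≤ Real.exp (n * (t * x - t * K + t ^ 2 / 2 * gam μ)) := by
    refine hch.trans ?_
    have h2 := pow_le_pow_left₀ (integral_nonneg fun y => (Real.exp_pos _).le) hmgf n
    refine (mul_le_mul_of_nonneg_left h2 (Real.exp_pos _).le).trans (le_of_eq ?_)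
    rw [← Real.exp_nat_mul, ← Real.exp_add]
    congr 1; ring
  have hae : ∀ᵐ ω ∂P, ∀ i, X i ω ∈ Set.Icc (0:ℝ) 1 ∧ 0 < YY μ l (X i ω) := by
    rw [ae_all_iff]
    intro i
    have h2 : ∀ᵐ y ∂(Measure.map (X i) P), y ∈ Set.Icc (0:ℝ) 1 ∧ 0 < YY μ l y := by
      rw [hdist i]; exact hs.and hYp
    exact ae_of_ae_map (hmeas i).aemeasurable h2
  calc P {ω | (Kinf (emp X ω) μ).toReal ≤ x}
      ≤ P {ω | (∑ i, V i) ω ≤ n * x} := by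
        apply measure_mono_ae
        filter_upwards [hae] with ω hω hle
        change (Kinf (emp X ω) μ).toReal ≤ x at hle
        change (∑ i, V i) ω ≤ n * x
        haveI := emp_prob hn X ω
        have hset : MeasurableSet {y | 0 < YY μ l y} := measurableSet_lt measurable_const (YY_meas _ _)
        have hge := Kinf_ge (emp X ω) μ l h1 hl hl1
          (emp_ae X ω _ hset fun i => (hω i).2) (emp_integrable hn X ω _)
        have hnt := Kinf_ne_top (emp X ω) (emp_ae X ω _ measurableSet_Icc fun i => (hω i).1) μ h0 h1
        have h3 := (ENNReal.ofReal_le_iff_le_toReal hnt).1 hge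
        rw [emp_integral] at h3
        have hnp : (0:ℝ) < n := by exact_mod_cast hn
        have h4 := (h3.trans hle)
        rw [inv_mul_le_iff₀ hnp] at h4
        rw [Finset.sum_apply]
        exact h4
    _ = ENNReal.ofReal (P.real {ω | (∑ i, V i) ω ≤ n * x}) := by
        rw [ofReal_measureReal]
    _ ≤ _ := ENNReal.ofReal_le_ofReal hfin

/-- Concentration result for `K_inf`: for i.i.d. `X_1, …, X_n` with distribution `ν` on `[0,1]`
and `μ ∈ (E(ν), 1)`, one has `γ ≥ 2` and, for `x < K_inf(ν, μ)`,
`P[K_inf(ν̂_n, μ) ≤ x] ≤ exp(−nγ/8) ≤ exp(−n/4)` when `x ≤ K_inf(ν, μ) − γ/2`, and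
`P[K_inf(ν̂_n, μ) ≤ x] ≤ exp(−n (K_inf(ν, μ) − x)² / (2γ))` otherwise. -/
theorem kinf_concentration {Ω : Type*} [MeasurableSpace Ω]
    (P : Measure Ω) [IsProbabilityMeasure P]
    (ν : Measure ℝ) [IsProbabilityMeasure ν] (hsupp : ν (Set.Icc (0:ℝ) 1)ᶜ = 0)
    (n : ℕ) (hn : 1 ≤ n) (X : Fin n → Ω → ℝ) (hmeas : ∀ i, Measurable (X i))
    (hindep : iIndepFun X P)
    (hdist : ∀ i, Measure.map (X i) P = ν)
    (μ : ℝ) (hμ : μ ∈ Set.Ioo (∫ y, y ∂ν) 1)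
    (x : ℝ) (hx : x < (Kinf ν μ).toReal) :
    2 ≤ gam μ ∧
    (x ≤ (Kinf ν μ).toReal - gam μ / 2 →
      P {ω | (Kinf (emp X ω) μ).toReal ≤ x}
          ≤ ENNReal.ofReal (Real.exp (-(n * gam μ) / 8)) ∧
        Real.exp (-(n * gam μ) / 8) ≤ Real.exp (-(n : ℝ) / 4)) ∧
    ((Kinf ν μ).toReal - gam μ / 2 < x →
      P {ω | (Kinf (emp X ω) μ).toReal ≤ x}
        ≤ ENNReal.ofReal (Real.exp (-(n * ((Kinf ν μ).toReal - x) ^ 2) / (2 * gam μ)))) := by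
  have h1 : μ < 1 := hμ.2
  have hE := hμ.1
  have hs : ∀ᵐ x ∂ν, x ∈ Set.Icc (0:ℝ) 1 := hsupp
  have h0 : 0 ≤ μ := by
    have : 0 ≤ ∫ y, y ∂ν := integral_nonneg_of_ae (hs.mono fun y hy => hy.1)
    linarith
  have hg := two_le_gam h0 h1
  have hn0 : (0:ℝ) ≤ n := Nat.cast_nonneg n
  refine ⟨hg, fun hx1 => ⟨?_, ?_⟩, fun hx2 => ?_⟩
  · refine (main_bound P ν hsupp n hn X hmeas hindep hdist μ hE h0 h1 x (1 / 2)
      (by norm_num) le_rfl).trans ?_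
    apply ENNReal.ofReal_le_ofReal
    apply Real.exp_le_exp.2
    have : 1 / 2 * x - 1 / 2 * (Kinf ν μ).toReal + (1 / 2) ^ 2 / 2 * gam μ ≤ - gam μ / 8 := by
      linarith
    have := mul_le_mul_of_nonneg_left this hn0
    linarith
  · apply Real.exp_le_exp.2
    have := mul_le_mul_of_nonneg_left hg hn0
    linarith
  · have hgp : 0 < gam μ := by linarith
    refine (main_bound P ν hsupp n hn X hmeas hindep hdist μ hE h0 h1 x
      (((Kinf ν μ).toReal - x) / gam μ) (div_nonneg (by linarith) hgp.le) ?_).trans ?_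
    · rw [div_le_iff₀ hgp]; linarith
    · apply ENNReal.ofReal_le_ofReal
      apply Real.exp_le_exp.2
      apply le_of_eq
      field_simp
      ring
end

section
/- Let X_1, X_2, … be a sequence of i.i.d. random variables with values in [0,1] and mean μ, and let μ̂_n = (1/n) Σ_{i=1}^n X_i. Then for all ε ≥ 0 and all integers N ≥ 1, E[ ( sup_{n ≥ N} ( μ − μ̂_n − ε ) )⁺ ] ≤ √(π/8) · √(1/N) · e^{−2 N ε²}, where (x)⁺ = max(x, 0). -/
open MeasureTheory ProbabilityTheory Real ENNReal
open scoped Classical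


lemma ville_prod {Ω : Type*} [MeasurableSpace Ω] (P : Measure Ω) [IsProbabilityMeasure P]
    (Y : ℕ → Ω → ℝ) (hm : ∀ i, Measurable (Y i)) (hnn : ∀ i ω, 0 ≤ Y i ω)
    (hind : iIndepFun Y P) (hint : ∀ i, Integrable (Y i) P) (h1 : ∀ i, ∫ ω, Y i ω ∂P = 1)
    (c : ℝ) (hc : 0 < c) :
    P {ω | ∃ n, c ≤ ∏ i ∈ Finset.range (n + 1), Y i ω} ≤ ENNReal.ofReal c⁻¹ := by
  have hsm : ∀ i, StronglyMeasurable (Y i) := fun i => (hm i).stronglyMeasurable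
  set M : ℕ → Ω → ℝ := fun n => ∏ i ∈ Finset.range (n + 1), Y i with hM
  have hMs : ∀ n, M (n + 1) = M n * Y (n + 1) := fun n => by
    simp only [hM]; rw [Finset.prod_range_succ _ (n + 1)]
  have hMap : ∀ n ω, M n ω = ∏ i ∈ Finset.range (n + 1), Y i ω := fun n ω => by
    simp [hM]
  have hMI : ∀ n, IndepFun (M n) (Y (n + 1)) P := fun n =>
    hind.indepFun_prod_range_succ hm (n + 1)
  have hMint : ∀ n, Integrable (M n) P ∧ ∫ ω, M n ω ∂P = 1 := by
    intro n
    induction n with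
    | zero => simp [hM, hint, h1]
    | succ n ih =>
      rw [hMs]
      refine ⟨(hMI n).integrable_mul ih.1 (hint _), ?_⟩
      rw [(hMI n).integral_mul_eq_mul_integral ih.1.aestronglyMeasurable (hint _).aestronglyMeasurable,
        ih.2, h1, mul_one]
  have hMnn : 0 ≤ M := fun n ω => by
    rw [hMap]; exact Finset.prod_nonneg fun i _ => hnn i ω
  have hadp : StronglyAdapted (Filtration.natural Y hsm) M := by
    intro n
    refine Finset.stronglyMeasurable_prod _ fun i hi => ?_
    exact (Filtration.stronglyAdapted_natural hsm i).mono
      ((Filtration.natural Y hsm).mono (by simpa [Nat.lt_succ_iff] using hi))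
  have hmart : Martingale M (Filtration.natural Y hsm) P := by
    refine martingale_nat hadp (fun n => (hMint n).1) fun n => ?_
    have e1 := condExp_mul_of_stronglyMeasurable_left (hadp n)
      (by rw [← hMs]; exact (hMint _).1) (hint (n + 1))
    have e2 := hind.condExp_natural_ae_eq_of_lt hsm (Nat.lt_succ_self n)
    rw [hMs]
    filter_upwards [e1, e2] with ω h h'
    rw [h, Pi.mul_apply, h', h1, mul_one]
  have hfin : ∀ K, P {ω | ∃ n ≤ K, c ≤ M n ω} ≤ ENNReal.ofReal c⁻¹ := by
    intro K
    obtain ⟨d, hd⟩ : ∃ d : NNReal, (d : ℝ) = c := ⟨c.toNNReal, Real.coe_toNNReal c hc.le⟩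
    have h := maximal_ineq hmart.submartingale hMnn (ε := d) K
    have hset : {ω | ∃ n ≤ K, c ≤ M n ω} = {ω | (d : ℝ) ≤
        (Finset.range (K + 1)).sup' Finset.nonempty_range_add_one fun k => M k ω} := by
      ext ω
      simp [Finset.le_sup'_iff, hd]
    rw [← hset] at h
    have h2 : ∫ ω in {ω | ∃ n ≤ K, c ≤ M n ω}, M K ω ∂P ≤ 1 := by
      rw [← (hMint K).2]
      exact setIntegral_le_integral (hMint K).1 (Filter.Eventually.of_forall fun ω => hMnn K ω)
    have h3 := h.trans (ENNReal.ofReal_le_ofReal h2)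
    have hcc : (d : ℝ≥0∞) = ENNReal.ofReal c := by
      rw [← hd, ENNReal.ofReal_coe_nnreal]
    rw [hcc, ENNReal.ofReal_one] at h3
    rw [ENNReal.ofReal_inv_of_pos hc, ← one_div, ENNReal.le_div_iff_mul_le (by simp [hc]) (by simp), mul_comm]
    exact h3
  have hU : {ω | ∃ n, c ≤ ∏ i ∈ Finset.range (n + 1), Y i ω} = ⋃ K, {ω | ∃ n ≤ K, c ≤ M n ω} := by
    ext ω
    simp only [Set.mem_ofPred_eq, Set.mem_iUnion, hMap]
    exact ⟨fun ⟨n, h⟩ => ⟨n, n, le_rfl, h⟩, fun ⟨_, n, _, h⟩ => ⟨n, h⟩⟩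
  rw [hU, Monotone.measure_iUnion]
  · exact iSup_le hfin
  · intro a b hab ω ⟨n, hn, h⟩
    exact ⟨n, hn.trans hab, h⟩

lemma max_hoeffding {Ω : Type*} [MeasurableSpace Ω]
    (P : Measure Ω) [IsProbabilityMeasure P]
    (X : ℕ → Ω → ℝ) (μ : ℝ) (hmeas : ∀ i, Measurable (X i))
    (hindep : iIndepFun X P)
    (hident : ∀ i, IdentDistrib (X i) (X 0) P P)
    (hrange : ∀ i, ∀ᵐ ω ∂P, X i ω ∈ Set.Icc (0:ℝ) 1)
    (hmean : ∫ ω, X 0 ω ∂P = μ)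
    (x : ℝ) (hx : 0 < x) (N : ℕ) (hN : 1 ≤ N) :
    P {ω | ∃ n, N ≤ n ∧ x ≤ μ - (∑ i ∈ Finset.range n, X i ω) / n}
      ≤ ENNReal.ofReal (Real.exp (-2 * N * x ^ 2)) := by
  have hmean' : ∀ i, ∫ ω, X i ω ∂P = μ := fun i => by rw [(hident i).integral_eq, hmean]
  have hsub : ∀ i, HasSubgaussianMGF (fun ω => X i ω - μ) ((‖(1:ℝ) - 0‖₊ / 2) ^ 2) P := fun i => by
    have := hasSubgaussianMGF_of_mem_Icc (hmeas i).aemeasurable (hrange i)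
    rwa [hmean'] at this
  set m : ℕ → ℝ := fun i => ∫ ω, Real.exp (-(4 * x) * (X i ω - μ)) ∂P with hm
  have hint : ∀ i, Integrable (fun ω => Real.exp (-(4 * x) * (X i ω - μ))) P :=
    fun i => (hsub i).integrable_exp_mul _
  have hmpos : ∀ i, 0 < m i := fun i => integral_exp_pos (hint i)
  have hmle : ∀ i, m i ≤ Real.exp (2 * x ^ 2) := fun i => by
    have := (hsub i).mgf_le (-(4 * x))
    refine (this.trans_eq ?_)
    congr 1
    push_cast
    simp
    ring
  have hV := ville_prod P (fun i ω => Real.exp (-(4 * x) * (X i ω - μ)) / m i)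
    (fun i => by have := hmeas i; fun_prop) (fun i ω => div_nonneg (Real.exp_pos _).le (hmpos i).le)
    (hindep.comp (fun i y => Real.exp (-(4 * x) * (y - μ)) / m i) (fun i => by fun_prop))
    (fun i => (hint i).div_const _)
    (fun i => by rw [integral_div]; exact div_self (hmpos i).ne')
    (Real.exp (2 * N * x ^ 2)) (Real.exp_pos _)
  rw [← Real.exp_neg] at hV
  rw [show -2 * (N:ℝ) * x ^ 2 = -(2 * N * x ^ 2) by ring]
  refine (measure_mono ?_).trans hV
  rintro ω ⟨n, hn, h⟩
  obtain ⟨k, rfl⟩ : ∃ k, n = k + 1 := ⟨n - 1, by omega⟩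
  refine ⟨k, ?_⟩
  have hpos : (0:ℝ) < ((k + 1 : ℕ) : ℝ) := by positivity
  have hnR : (N:ℝ) ≤ ((k + 1 : ℕ) : ℝ) := by exact_mod_cast hn
  generalize hq : ((k + 1 : ℕ) : ℝ) = q at *
  have h' : (∑ i ∈ Finset.range (k + 1), X i ω) ≤ (μ - x) * q := by
    rw [← div_le_iff₀ hpos]; linarith
  calc Real.exp (2 * N * x ^ 2) ≤ Real.exp (2 * q * x ^ 2) := by gcongr
    _ ≤ Real.exp (∑ i ∈ Finset.range (k + 1), (-(4 * x) * (X i ω - μ) - 2 * x ^ 2)) := by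
      apply Real.exp_le_exp.2
      rw [Finset.sum_sub_distrib, ← Finset.mul_sum, Finset.sum_sub_distrib]
      simp only [Finset.sum_const, Finset.card_range, nsmul_eq_mul, hq]
      nlinarith [mul_le_mul_of_nonneg_left h' hx.le]
    _ = ∏ i ∈ Finset.range (k + 1), (Real.exp (-(4 * x) * (X i ω - μ)) / Real.exp (2 * x ^ 2)) := by
      rw [Real.exp_sum]; simp only [Real.exp_sub]
    _ ≤ _ := by
      apply Finset.prod_le_prod
      · intros; positivity
      · intro i _
        exact div_le_div_of_nonneg_left (Real.exp_pos _).le (hmpos i) (hmle i)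

/-- Integrated maximal Hoeffding inequality: for i.i.d. random variables `X_1, X_2, …` with
values in `[0,1]` and mean `μ`, for all `ε ≥ 0` and `N ≥ 1`,
`E[(sup_{n ≥ N} (μ − μ̂_n − ε))⁺] ≤ √(π/8) √(1/N) e^{−2Nε²}`. -/
theorem integrated_maximal_hoeffding {Ω : Type*} [MeasurableSpace Ω]
    (P : Measure Ω) [IsProbabilityMeasure P]
    (X : ℕ → Ω → ℝ) (μ : ℝ) (hmeas : ∀ i, Measurable (X i))
    (hindep : iIndepFun X P)
    (hident : ∀ i, IdentDistrib (X i) (X 0) P P)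
    (hrange : ∀ i, ∀ᵐ ω ∂P, X i ω ∈ Set.Icc (0:ℝ) 1)
    (hmean : ∫ ω, X 0 ω ∂P = μ)
    (ε : ℝ) (hε : 0 ≤ ε) (N : ℕ) (hN : 1 ≤ N) :
    ∫⁻ ω, ENNReal.ofReal (⨆ n : {m : ℕ // N ≤ m},
        (μ - (∑ i ∈ Finset.range (n : ℕ), X i ω) / (n : ℕ) - ε)) ∂P
      ≤ ENNReal.ofReal
          (Real.sqrt (π / 8) * Real.sqrt (1 / N) * Real.exp (-2 * N * ε ^ 2)) := by
  have hN0 : (0:ℝ) < N := by exact_mod_cast hN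
  have : Nonempty {m : ℕ // N ≤ m} := ⟨⟨N, le_rfl⟩⟩
  set F : Ω → ℝ := fun ω => ⨆ n : {m : ℕ // N ≤ m},
        (μ - (∑ i ∈ Finset.range (n : ℕ), X i ω) / (n : ℕ) - ε) with hF
  have hFm : Measurable F := by
    refine Measurable.iSup fun n => ?_
    fun_prop
  have e1 : ∫⁻ ω, ENNReal.ofReal (F ω) ∂P = ∫⁻ ω, ENNReal.ofReal (max (F ω) 0) ∂P := by
    refine lintegral_congr fun ω => ?_
    simp
  change ∫⁻ ω, ENNReal.ofReal (F ω) ∂P ≤ _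
  rw [e1, lintegral_eq_lintegral_meas_lt P (f := fun ω => max (F ω) 0) (Filter.Eventually.of_forall fun ω => le_max_right _ _)
    (hFm.max measurable_const).aemeasurable]
  have hgi : Integrable (fun t : ℝ => Real.exp (-(2 * N) * t ^ 2)) :=
    integrable_exp_neg_mul_sq (by positivity)
  calc ∫⁻ t in Set.Ioi (0:ℝ), P {a | t < max (F a) 0}
      ≤ ∫⁻ t in Set.Ioi (0:ℝ), ENNReal.ofReal
          (Real.exp (-2 * N * ε ^ 2) * Real.exp (-(2 * N) * t ^ 2)) := by
        refine setLIntegral_mono' measurableSet_Ioi fun t ht => ?_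
        have ht : 0 < t := ht
        refine (measure_mono ?_).trans ((max_hoeffding P X μ hmeas hindep hident hrange hmean
          (t + ε) (by linarith) N hN).trans (ENNReal.ofReal_le_ofReal ?_))
        · intro ω hω
          have hω : t < F ω := by
            rcases lt_max_iff.1 (show t < max (F ω) 0 from hω) with h | h
            · exact h
            · exact absurd h ht.not_gt
          obtain ⟨n, hn⟩ := exists_lt_of_lt_ciSup hω
          exact ⟨n, n.2, by linarith⟩
        · rw [← Real.exp_add]
          apply Real.exp_le_exp.2
          nlinarith [mul_nonneg hN0.le (mul_nonneg ht.le hε)]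
    _ = ENNReal.ofReal (∫ t in Set.Ioi (0:ℝ),
          (Real.exp (-2 * N * ε ^ 2) * Real.exp (-(2 * N) * t ^ 2))) := by
        rw [ofReal_integral_eq_lintegral_ofReal]
        · exact (hgi.const_mul _).restrict
        · exact Filter.Eventually.of_forall fun t => by positivity
    _ ≤ _ := by
        apply ENNReal.ofReal_le_ofReal
        rw [integral_const_mul, integral_gaussian_Ioi, mul_comm]
        apply le_of_eq
        congr 1
        rw [← Real.sqrt_mul (by positivity), show π / 8 * (1 / (N:ℝ)) = (π / (2 * N)) / 2 ^ 2 by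
          field_simp; norm_num, Real.sqrt_div (x := π / (2 * N)) (by positivity) (2 ^ 2), Real.sqrt_sq (by norm_num)]
end

section
/- Let X_1, X_2, … be a sequence of i.i.d. random variables with values in [0,1] and mean μ, and let μ̂_n = (1/n) Σ_{i=1}^n X_i. Then for all integers K ≥ 1 and T ≥ 1, Σ_{n=1}^{T} E[ ( μ̂_n − μ − √(K/T) )⁺ ] ≤ (π/4) √(T/K), where (x)⁺ = max(x, 0). -/
open MeasureTheory ProbabilityTheory Real ENNReal
open scoped Classical

lemma aux_hoeffding {Ω : Type*} [MeasurableSpace Ω]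
    (P : Measure Ω) [IsProbabilityMeasure P]
    (X : ℕ → Ω → ℝ) (μ : ℝ) (hmeas : ∀ i, Measurable (X i))
    (hindep : iIndepFun X P)
    (hident : ∀ i, IdentDistrib (X i) (X 0) P P)
    (hrange : ∀ i, ∀ᵐ ω ∂P, X i ω ∈ Set.Icc (0:ℝ) 1)
    (hmean : ∫ ω, X 0 ω ∂P = μ) (n : ℕ) (hn : 1 ≤ n) (u : ℝ) (hu : 0 ≤ u) :
    P {ω | u ≤ (∑ i ∈ Finset.range n, X i ω) / n - μ} ≤
      ENNReal.ofReal (Real.exp (-2 * u ^ 2) ^ n) := by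
  have hn' : (0:ℝ) < n := by exact_mod_cast hn
  have hm : ∀ i, ∫ ω, X i ω ∂P = μ := fun i => by rw [(hident i).integral_eq, hmean]
  have hsub : ∀ i < n, HasSubgaussianMGF (fun ω => X i ω - μ) ((‖(1:ℝ) - 0‖₊ / 2) ^ 2) P := by
    intro i _
    have := hasSubgaussianMGF_of_mem_Icc (hmeas i).aemeasurable (hrange i)
    rw [hm i] at this
    exact this
  have hind : iIndepFun (fun i ω => X i ω - μ) P :=
    hindep.comp (fun _ x => x - μ) (fun _ => by fun_prop)
  have key := HasSubgaussianMGF.measure_sum_range_ge_le_of_iIndepFun hind hsub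
    (ε := n * u) (by positivity)
  have hset : {ω | u ≤ (∑ i ∈ Finset.range n, X i ω) / n - μ} =
      {ω | n * u ≤ ∑ i ∈ Finset.range n, (X i ω - μ)} := by
    ext ω
    simp only [Set.mem_ofPred_eq, Finset.sum_sub_distrib, Finset.sum_const, Finset.card_range,
      nsmul_eq_mul]
    rw [le_sub_iff_add_le, le_div_iff₀ hn']
    constructor <;> intro h <;> linarith
  rw [hset, ← ENNReal.ofReal_toReal (measure_ne_top P _)]
  apply ENNReal.ofReal_le_ofReal
  refine key.trans (le_of_eq ?_)
  rw [← Real.exp_nat_mul]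
  congr 1
  simp
  field_simp
  try ring

lemma aux_integral (ε : ℝ) (hε : 0 < ε) :
    ∫⁻ t in Set.Ioi (0:ℝ), ENNReal.ofReal (1 / (2 * (ε + t) ^ 2)) = ENNReal.ofReal (1 / (2 * ε)) := by
  have hd : ∀ x ∈ Set.Ici (0:ℝ),
      HasDerivAt (fun t => - (1 / (2 * (ε + t)))) (1 / (2 * (ε + x) ^ 2)) x := by
    intro x hx
    have hx : (0:ℝ) ≤ x := hx
    have h1 : HasDerivAt (fun t => 2 * (ε + t)) 2 x := by
      simpa using ((hasDerivAt_id x).const_add ε).const_mul 2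
    have h2 := (h1.inv (by positivity)).neg
    simp only [one_div]
    refine HasDerivAt.congr_deriv (f' := - (-2 / (2 * (ε + x)) ^ 2)) h2 ?_
    have : ε + x ≠ 0 := by positivity
    field_simp
    try ring
  have hpos : ∀ x ∈ Set.Ioi (0:ℝ), 0 ≤ 1 / (2 * (ε + x) ^ 2) := by
    intro x _; positivity
  have ht : Filter.Tendsto (fun t => - (1 / (2 * (ε + t)))) Filter.atTop (nhds 0) := by
    rw [← neg_zero]
    apply Filter.Tendsto.neg
    simp only [one_div]
    apply Filter.Tendsto.inv_tendsto_atTop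
    apply Filter.Tendsto.const_mul_atTop (by norm_num)
    exact Filter.tendsto_atTop_add_const_left _ _ Filter.tendsto_id
  rw [← ofReal_integral_eq_lintegral_ofReal]
  · rw [integral_Ioi_of_hasDerivAt_of_nonneg' hd hpos ht]
    simp
  · exact integrableOn_Ioi_deriv_of_nonneg' hd hpos ht
  · exact (ae_restrict_iff' measurableSet_Ioi).2 (Filter.Eventually.of_forall hpos)

lemma aux_geom (u : ℝ) (hu : 0 < u) (T : ℕ) :
    ∑ n ∈ Finset.Icc 1 T, Real.exp (-2 * u ^ 2) ^ n ≤ 1 / (2 * u ^ 2) := by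
  set q := Real.exp (-2 * u ^ 2) with hq
  have hq0 : 0 < q := Real.exp_pos _
  have hq1 : q * (1 + 2 * u ^ 2) ≤ 1 := by
    have h := Real.add_one_le_exp (2 * u ^ 2)
    have h2 : q * Real.exp (2 * u ^ 2) = 1 := by rw [hq, ← Real.exp_add]; simp
    nlinarith
  have hs : ∀ T : ℕ, (∑ n ∈ Finset.Icc 1 T, q ^ n) * (1 - q) = q - q ^ (T + 1) := by
    intro T
    induction T with
    | zero => simp
    | succ k ih => rw [Finset.sum_Icc_succ_top (by omega), add_mul, ih]; ring
  have hu2 : 0 < u ^ 2 := by positivity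
  have h1q : q * (2 * u ^ 2) ≤ 1 - q := by linarith
  have hS0 : 0 ≤ ∑ n ∈ Finset.Icc 1 T, q ^ n := Finset.sum_nonneg fun _ _ => by positivity
  rw [le_div_iff₀ (by positivity)]
  have h3 := hs T
  have h4 : 0 < q ^ (T + 1) := by positivity
  have h5 := mul_le_mul_of_nonneg_left h1q hS0
  have : q * ((∑ n ∈ Finset.Icc 1 T, q ^ n) * (2 * u ^ 2)) ≤ q * 1 := by linarith
  exact le_of_mul_le_mul_left this hq0

/-- Control of the right deviations of the empirical means: for i.i.d. random variables
`X_1, X_2, …` with values in `[0,1]` and mean `μ`, for all integers `K, T ≥ 1`,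
`∑_{n=1}^{T} E[(μ̂_n − μ − √(K/T))⁺] ≤ (π/4) √(T/K)`. -/
theorem sum_right_deviations {Ω : Type*} [MeasurableSpace Ω]
    (P : Measure Ω) [IsProbabilityMeasure P]
    (X : ℕ → Ω → ℝ) (μ : ℝ) (hmeas : ∀ i, Measurable (X i))
    (hindep : iIndepFun X P)
    (hident : ∀ i, IdentDistrib (X i) (X 0) P P)
    (hrange : ∀ i, ∀ᵐ ω ∂P, X i ω ∈ Set.Icc (0:ℝ) 1)
    (hmean : ∫ ω, X 0 ω ∂P = μ)
    (K T : ℕ) (hK : 1 ≤ K) (hT : 1 ≤ T) :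
    ∑ n ∈ Finset.Icc 1 T,
        ∫⁻ ω, ENNReal.ofReal
          ((∑ i ∈ Finset.range n, X i ω) / n - μ - Real.sqrt ((K : ℝ) / T)) ∂P
      ≤ ENNReal.ofReal (π / 4 * Real.sqrt ((T : ℝ) / K)) := by
  have hK' : (0:ℝ) < K := by exact_mod_cast hK
  have hT' : (0:ℝ) < T := by exact_mod_cast hT
  set ε := Real.sqrt ((K : ℝ) / T) with hεd
  have hε : 0 < ε := Real.sqrt_pos.2 (by positivity)
  have hinv : Real.sqrt ((T : ℝ) / K) = 1 / ε := by
    rw [hεd, one_div, ← Real.sqrt_inv, inv_div]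
  have step : ∀ n ∈ Finset.Icc 1 T,
      ∫⁻ ω, ENNReal.ofReal ((∑ i ∈ Finset.range n, X i ω) / n - μ - ε) ∂P
      ≤ ∫⁻ t in Set.Ioi (0:ℝ), ENNReal.ofReal (Real.exp (-2 * (ε + t) ^ 2) ^ n) := by
    intro n hn
    have hn1 : 1 ≤ n := (Finset.mem_Icc.1 hn).1
    have e1 : ∀ ω, ENNReal.ofReal ((∑ i ∈ Finset.range n, X i ω) / n - μ - ε) =
        ENNReal.ofReal (max ((∑ i ∈ Finset.range n, X i ω) / n - μ - ε) 0) := by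
      intro ω; rw [ENNReal.ofReal_max]; simp
    simp_rw [e1]
    rw [lintegral_eq_lintegral_meas_le P
      (f := fun ω => max ((∑ i ∈ Finset.range n, X i ω) / n - μ - ε) 0) (Filter.Eventually.of_forall fun ω => le_max_right _ _)
      (by fun_prop)]
    refine setLIntegral_mono' measurableSet_Ioi ?_
    intro t ht
    have ht : (0:ℝ) < t := ht
    refine le_trans (measure_mono ?_) (aux_hoeffding P X μ hmeas hindep hident hrange hmean n hn1
      (ε + t) (by positivity))
    intro ω hω
    simp only [Set.mem_ofPred_eq] at hω ⊢
    rcases le_max_iff.1 hω with h | h <;> linarith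
  refine (Finset.sum_le_sum step).trans ?_
  rw [← lintegral_finsetSum _ (fun n _ => by fun_prop)]
  calc _ ≤ ∫⁻ t in Set.Ioi (0:ℝ), ENNReal.ofReal (1 / (2 * (ε + t) ^ 2)) := by
        refine setLIntegral_mono' measurableSet_Ioi ?_
        intro t ht
        have ht : (0:ℝ) < t := ht
        rw [← ENNReal.ofReal_sum_of_nonneg (fun _ _ => by positivity)]
        exact ENNReal.ofReal_le_ofReal (aux_geom (ε + t) (by positivity) T)
    _ = ENNReal.ofReal (1 / (2 * ε)) := aux_integral ε hε
    _ ≤ _ := by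
        apply ENNReal.ofReal_le_ofReal
        rw [hinv]
        have : 1 / (2 * ε) = 1 / 2 * (1 / ε) := by field_simp
        rw [this]
        apply mul_le_mul_of_nonneg_right _ (by positivity)
        linarith [Real.pi_gt_three]
end

section
/- Let (Z_i)_{i ≥ 1} be a sequence of i.i.d. real random variables with E[Z_1] > 0 and such that Z_i ≤ α almost surely for some α > 0. For integers T ≥ 1 and K ≥ 1, define the stopping time τ = min( inf{ n ≥ 1 : Σ_{i=1}^n Z_i > ln(T/(Kn)) }, T ). Then for all T ≥ K e^{α}, one has E[τ] ≤ ( w + α + ln 2 ) / E[Z_1], where w > 0 is the unique positive real number satisfying w e^{w} = α T / K (i.e., w = W(αT/K) with W Lambert's function). -/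
open MeasureTheory ProbabilityTheory Real ENNReal
open scoped Classical

/-- the pointwise bound on the stopped sum -/
lemma stopped_sum_le (z : ℕ → ℝ) (α : ℝ) (hα : 0 < α) (hz : ∀ i, z i ≤ α)
    (T K : ℕ) (hK : 1 ≤ K) (hT : 1 ≤ T)
    (w : ℝ) (hw : 0 < w) (hwe : w * Real.exp w = α * T / K) (t : ℕ) (ht1 : 1 ≤ t)
    (htT : t = T ∨ Real.log ((T : ℝ) / (K * t)) < ∑ i ∈ Finset.range t, z i)
    (hlt : ∀ n, 1 ≤ n → n < t → ∑ i ∈ Finset.range n, z i ≤ Real.log ((T : ℝ) / (K * n))) :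
    ∑ i ∈ Finset.range t, z i ≤ w + α + Real.log 2 := by
  have hlog2 : 0 < Real.log 2 := Real.log_pos (by norm_num)
  have hK0 : (0 : ℝ) < K := by exact_mod_cast hK
  have hK1 : (1 : ℝ) ≤ K := by exact_mod_cast hK
  have hT0 : (0 : ℝ) < T := by exact_mod_cast hT
  have ht0 : (0 : ℝ) < t := by exact_mod_cast ht1
  have hwe' : w * Real.exp w * K = α * T := by rw [hwe]; field_simp
  -- `w ≤ α t`
  have hwt : w ≤ α * t := by
    by_contra! hcon
    have hexp : Real.exp (α * t) < Real.exp w := Real.exp_lt_exp.2 hcon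
    have h1 : α * t * Real.exp (α * t) < w * Real.exp w :=
      mul_lt_mul'' hcon hexp (by positivity) (by positivity)
    have h2 : α * t * Real.exp (α * t) * K < α * T := by
      rw [← hwe']; exact mul_lt_mul_of_pos_right h1 hK0
    have h3 : t * Real.exp (α * t) * K < T := by
      by_contra! h
      nlinarith [mul_le_mul_of_nonneg_left h hα.le]
    rcases htT with h | h
    · subst h
      have h5 : 1 ≤ Real.exp (α * t) := Real.one_le_exp (by positivity)
      have h6 : 1 ≤ Real.exp (α * t) * K := by nlinarith
      nlinarith
    · have hs : ∑ i ∈ Finset.range t, z i ≤ α * t := by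
        calc ∑ i ∈ Finset.range t, z i ≤ ∑ i ∈ Finset.range t, α :=
              Finset.sum_le_sum fun i _ => hz i
          _ = α * t := by simp [mul_comm]
      have h4 : Real.log ((T : ℝ) / (K * t)) < α * t := h.trans_le hs
      rw [Real.log_lt_iff_lt_exp (by positivity), div_lt_iff₀ (by positivity)] at h4
      nlinarith
  obtain ⟨s, rfl⟩ : ∃ s, t = s + 1 := ⟨t - 1, by omega⟩
  rw [Finset.sum_range_succ]
  rcases Nat.eq_zero_or_pos s with rfl | hs
  · simp; linarith [hz 0]
  have hs1 : (1 : ℝ) ≤ s := by exact_mod_cast hs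
  have hs0 : (0 : ℝ) < s := by linarith
  have h1 := hlt s hs (by omega)
  have h2 : Real.log ((T : ℝ) / (K * s)) ≤ w + Real.log 2 := by
    rw [Real.log_le_iff_le_exp (by positivity), Real.exp_add, Real.exp_log (by norm_num),
      div_le_iff₀ (by positivity)]
    push_cast at hwt
    have h3 : w ≤ α * (2 * s) := hwt.trans (mul_le_mul_of_nonneg_left (by linarith) hα.le)
    have h4 : α * T ≤ α * (2 * s) * (Real.exp w * K) := by
      rw [← hwe', mul_assoc]; exact mul_le_mul_of_nonneg_right h3 (by positivity)
    have := le_of_mul_le_mul_left (by linarith : α * T ≤ α * (2 * s * (Real.exp w * K))) hα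
    linarith
  linarith [hz s]

lemma wald_step {Ω : Type*} [mΩ : MeasurableSpace Ω]
    (P : Measure Ω) [IsProbabilityMeasure P]
    (Z : ℕ → Ω → ℝ) (hmeas : ∀ i, Measurable (Z i))
    (hindep : iIndepFun Z P) (b : ℕ → ℝ) (k : ℕ) (hint : Integrable (Z k) P) :
    MeasurableSet {ω | ∀ n, 1 ≤ n → n ≤ k → ∑ i ∈ Finset.range n, Z i ω ≤ b n} ∧
    ∫ ω in {ω | ∀ n, 1 ≤ n → n ≤ k → ∑ i ∈ Finset.range n, Z i ω ≤ b n}, Z k ω ∂P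
      = P.real {ω | ∀ n, 1 ≤ n → n ≤ k → ∑ i ∈ Finset.range n, Z i ω ≤ b n} * ∫ ω, Z k ω ∂P := by
  set A := {ω | ∀ n, 1 ≤ n → n ≤ k → ∑ i ∈ Finset.range n, Z i ω ≤ b n} with hA
  have hle : ∀ j, MeasurableSpace.comap (Z j) inferInstance ≤ mΩ := fun j => (hmeas j).comap_le
  let m₁ : MeasurableSpace Ω := ⨆ j ∈ ({k} : Set ℕ), MeasurableSpace.comap (Z j) inferInstance
  let m₂ : MeasurableSpace Ω := ⨆ j ∈ Set.Iio k, MeasurableSpace.comap (Z j) inferInstance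
  have hI : Indep m₁ m₂ P := indep_iSup_of_disjoint hle hindep (by simp)
  have hm₁ : m₁ ≤ mΩ := iSup₂_le fun j _ => hle j
  have hm₂ : m₂ ≤ mΩ := iSup₂_le fun j _ => hle j
  have hZk : Measurable[m₁] (Z k) :=
    (comap_measurable (Z k)).mono (le_iSup₂_of_le k rfl le_rfl) le_rfl
  have hZj : ∀ j < k, Measurable[m₂] (Z j) := fun j hj =>
    (comap_measurable (Z j)).mono (le_iSup₂_of_le j hj le_rfl) le_rfl
  have hAm : MeasurableSet[m₂] A := by
    rw [hA]
    simp only [Set.ofPred_forall]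
    refine MeasurableSet.iInter fun n => MeasurableSet.iInter fun _ => MeasurableSet.iInter fun h => ?_
    have hS : Measurable[m₂] (fun ω => ∑ i ∈ Finset.range n, Z i ω) :=
      Finset.measurable_sum _ fun i hi => hZj i (by have := Finset.mem_range.1 hi; omega)
    exact hS measurableSet_Iic
  refine ⟨hm₂ _ hAm, ?_⟩
  rw [← setIntegral_condExp hm₂ hint hAm]
  rw [setIntegral_congr_ae (g := fun _ => ∫ ω, Z k ω ∂P) (hm₂ _ hAm)]
  · simp
  · filter_upwards [condExp_indep_eq hm₁ hm₂ hZk.stronglyMeasurable hI] with ω h _ using h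

/-- Expected hitting time of the logarithmic barrier: for i.i.d. `(Z_i)` with `E[Z_1] > 0`,
`Z_i ≤ α` a.s., `α > 0`, and `τ = min(inf{n ≥ 1 : ∑_{i=1}^n Z_i > ln(T/(Kn))}, T)`,
one has, for `T ≥ K e^α`, `E[τ] ≤ (W(αT/K) + α + ln 2)/E[Z_1]`, where `w = W(αT/K)` is the
unique positive solution of `w e^w = αT/K`. -/
theorem expected_hitting_time_log_barrier {Ω : Type*} [MeasurableSpace Ω]
    (P : Measure Ω) [IsProbabilityMeasure P]
    (Z : ℕ → Ω → ℝ) (hmeas : ∀ i, Measurable (Z i))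
    (hindep : iIndepFun Z P)
    (hident : ∀ i, IdentDistrib (Z i) (Z 0) P P)
    (hint : Integrable (Z 0) P) (hpos : 0 < ∫ ω, Z 0 ω ∂P)
    (α : ℝ) (hα : 0 < α) (hZα : ∀ i, ∀ᵐ ω ∂P, Z i ω ≤ α)
    (T K : ℕ) (hK : 1 ≤ K) (hT : 1 ≤ T) (hTK : (K : ℝ) * Real.exp α ≤ T)
    (w : ℝ) (hw : 0 < w) (hwe : w * Real.exp w = α * T / K) :
    ∫ ω, ((sInf ({n : ℕ | 1 ≤ n ∧
          Real.log ((T : ℝ) / (K * n)) < ∑ i ∈ Finset.range n, Z i ω} ∪ {T}) : ℕ) : ℝ) ∂P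
      ≤ (w + α + Real.log 2) / ∫ ω, Z 0 ω ∂P := by
  set b : ℕ → ℝ := fun n => Real.log ((T : ℝ) / (K * n)) with hb
  set m := ∫ ω, Z 0 ω ∂P with hm
  set τ : Ω → ℕ := fun ω => sInf ({n : ℕ | 1 ≤ n ∧
          Real.log ((T : ℝ) / (K * n)) < ∑ i ∈ Finset.range n, Z i ω} ∪ {T}) with hτ
  let A : ℕ → Set Ω := fun k => {ω | ∀ n, 1 ≤ n → n ≤ k → ∑ i ∈ Finset.range n, Z i ω ≤ b n}
  have hmem : ∀ ω, τ ω ∈ ({n : ℕ | 1 ≤ n ∧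
      Real.log ((T : ℝ) / (K * n)) < ∑ i ∈ Finset.range n, Z i ω} ∪ {T}) :=
    fun ω => Nat.sInf_mem ⟨T, Or.inr rfl⟩
  have hτT : ∀ ω, τ ω ≤ T := fun ω => Nat.sInf_le (Or.inr rfl)
  have hτ1 : ∀ ω, 1 ≤ τ ω := fun ω => by
    rcases hmem ω with h | h
    · exact h.1
    · rw [Set.mem_singleton_iff] at h; omega
  have hbar : ∀ ω n, 1 ≤ n → n < τ ω → ∑ i ∈ Finset.range n, Z i ω ≤ b n := by
    intro ω n hn hlt
    by_contra! h
    have hle : τ ω ≤ n := Nat.sInf_le (Or.inl ⟨hn, h⟩)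
    omega
  have hAiff : ∀ ω k, k < T → (ω ∈ A k ↔ k < τ ω) := by
    intro ω k hk
    constructor
    · intro h
      by_contra! hle
      rcases hmem ω with h' | h'
      · exact absurd (h _ h'.1 hle) (not_le.2 h'.2)
      · rw [Set.mem_singleton_iff] at h'; omega
    · intro h n hn hnk
      exact hbar ω n hn (by omega)
  have hsum : ∀ (ω : Ω) (f : ℕ → Ω → ℝ),
      ∑ k ∈ Finset.range T, (A k).indicator (f k) ω = ∑ k ∈ Finset.range (τ ω), f k ω := by
    intro ω f
    simp only [Set.indicator_apply]
    rw [← Finset.sum_filter]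
    refine Finset.sum_congr ?_ fun _ _ => rfl
    ext k
    simp only [Finset.mem_filter, Finset.mem_range]
    constructor
    · rintro ⟨h1, h2⟩; exact (hAiff ω k h1).1 h2
    · intro h
      have h1 := h.trans_le (hτT ω)
      exact ⟨h1, (hAiff ω k h1).2 h⟩
  have hintk : ∀ k, Integrable (Z k) P := fun k => (hident k).integrable_iff.2 hint
  have hstep := fun k => wald_step P Z hmeas hindep b k (hintk k)
  have hAm : ∀ k, MeasurableSet (A k) := fun k => (hstep k).1
  have hW : ∀ k, ∫ ω, (A k).indicator (Z k) ω ∂P = P.real (A k) * m := fun k => by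
    rw [integral_indicator (hAm k), (hstep k).2, (hident k).integral_eq]
  have hEτ : ∫ ω, (τ ω : ℝ) ∂P = ∑ k ∈ Finset.range T, P.real (A k) := by
    have : ∀ ω, (τ ω : ℝ) = ∑ k ∈ Finset.range T, (A k).indicator (fun _ => (1 : ℝ)) ω := by
      intro ω
      rw [hsum ω (fun _ _ => 1)]; simp
    simp_rw [this]
    rw [integral_finsetSum _ fun k _ => (integrable_const _).indicator (hAm k)]
    refine Finset.sum_congr rfl fun k _ => ?_
    rw [integral_indicator (hAm k)]; simp
  change ∫ ω, (τ ω : ℝ) ∂P ≤ _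
  rw [le_div_iff₀ hpos, hEτ, Finset.sum_mul]
  simp_rw [← hW]
  have hI : ∀ k, Integrable ((A k).indicator (Z k)) P := fun k => (hintk k).indicator (hAm k)
  rw [← integral_finsetSum _ fun k _ => hI k]
  calc _ ≤ ∫ ω, (w + α + Real.log 2) ∂P := by
        refine integral_mono_ae (integrable_finsetSum _ fun k _ => hI k) (integrable_const _) ?_
        filter_upwards [ae_all_iff.2 hZα] with ω hω
        rw [hsum ω Z]
        refine stopped_sum_le (fun i => Z i ω) α hα hω T K hK hT w hw hwe (τ ω) (hτ1 ω) ?_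
          (hbar ω)
        rcases hmem ω with h | h
        · exact Or.inr h.2
        · exact Or.inl h
    _ = _ := by simp
end
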